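/- arXiv:1106.1991 — 2 statements merged into one kernel-verified Lean document; each statement's English description precedes it below -/
import Mathlib

section
/- Let Ω ⊂ ℝ² be open, ψ, h : Ω → ℝ smooth with ψ > 0 and div(ψ²∇h) = 0 on Ω, and suppose h ψ (i.e., φ = hψ) vanishes on ∂Ω. For a Lipschitz cutoff ζ with compact support in ℝ², one has the Caccioppoli-type inequality ∫_Ω |∇h|² ψ² ζ² ≤ 2 (∫_Ω |∇h|² ψ² ζ²)^{1/2} (∫_Ω φ² |∇ζ|²)^{1/2}, and hence ∫_Ω |∇h|² ψ² ζ² ≤ 4 ∫_Ω φ² |∇ζ|². -/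
open MeasureTheory Set

noncomputable def pdx (f : ℝ × ℝ → ℝ) (p : ℝ × ℝ) : ℝ := deriv (fun t => f (t, p.2)) p.1
noncomputable def pdy (f : ℝ × ℝ → ℝ) (p : ℝ × ℝ) : ℝ := deriv (fun t => f (p.1, t)) p.2

open Filter Topology

theorem exists_trunc : ∃ (T : ℕ → ℝ → ℝ) (C : ℝ), (∀ n, ContDiff ℝ 1 (T n)) ∧
    (∀ n, ∃ ε > 0, ∀ s, |s| < ε → T n s = 0) ∧ (∀ n s, |T n s| ≤ |s|) ∧
    (∀ n s, |deriv (T n) s| ≤ C) ∧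
    (∀ s, s ≠ 0 → ∀ᶠ n in atTop, T n s = s ∧ deriv (T n) s = 1) := by
  let b : ContDiffBump (0:ℝ) := ⟨1, 2, by norm_num, by norm_num⟩
  let τ : ℝ → ℝ := fun s => s * (1 - b s)
  have hτ : ContDiff ℝ 1 τ := by
    have := b.contDiff (n := 1)
    exact contDiff_id.mul (contDiff_const.sub this)
  have h0 : ∀ s, |s| ≤ 1 → τ s = 0 := fun s hs => by
    have : b s = 1 := b.one_of_mem_closedBall (by simpa [b] using hs)
    simp [τ, this]
  have h2 : ∀ s, 2 ≤ |s| → τ s = s := fun s hs => by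
    have : b s = 0 := b.zero_of_le_dist (by simpa [b] using hs)
    simp [τ, this]
  have hd : ∀ s, 2 < |s| → deriv τ s = 1 := fun s hs => by
    have : τ =ᶠ[𝓝 s] id := by
      filter_upwards [(isOpen_lt continuous_const continuous_abs).mem_nhds hs] with t ht
      exact h2 t (le_of_lt ht)
    rw [this.deriv_eq]; simp
  have hle : ∀ s, |τ s| ≤ |s| := fun s => by
    have h1 := b.nonneg (x := s)
    have h2 := b.le_one (x := s)
    simp only [τ, abs_mul]
    have : |1 - b s| ≤ 1 := by rw [abs_le]; constructor <;> linarith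
    exact mul_le_of_le_one_right (abs_nonneg _) this
  obtain ⟨C, hC⟩ := (isCompact_Icc (a := (-2:ℝ)) (b := 2)).exists_bound_of_continuousOn
    (hτ.continuous_deriv le_rfl).continuousOn
  have hder : ∀ (n : ℕ) s, deriv (fun s => τ ((n+1 : ℝ) * s) / (n+1)) s
      = deriv τ ((n+1) * s) := fun n s => by
    have h1 : HasDerivAt τ (deriv τ ((n+1) * s)) ((n+1) * s) :=
      (hτ.differentiable one_ne_zero _).hasDerivAt
    have h3 := (h1.comp s ((hasDerivAt_id s).const_mul (n+1 : ℝ))).div_const (n+1 : ℝ)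
    have hn : (n+1 : ℝ) ≠ 0 := by positivity
    refine (HasDerivAt.deriv (h3.congr_deriv ?_))
    field_simp
  refine ⟨fun n s => τ ((n+1) * s) / (n+1), max C 1, fun n => ?_, fun n => ?_, fun n s => ?_,
    fun n s => ?_, fun s hs => ?_⟩
  · exact (hτ.comp (contDiff_const.mul contDiff_id)).div_const _
  · refine ⟨1/(n+1), by positivity, fun s hs => ?_⟩
    beta_reduce
    rw [h0, zero_div]
    have hn : (0:ℝ) < n+1 := by positivity
    rw [abs_mul, abs_of_pos hn]
    rw [lt_div_iff₀ hn] at hs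
    linarith
  · have hn : (0:ℝ) < n+1 := by positivity
    rw [abs_div, abs_of_pos hn, div_le_iff₀ hn]
    refine (hle _).trans ?_
    rw [abs_mul, abs_of_pos hn, mul_comm]
  · rw [hder]
    by_cases h : 2 < |(n+1 : ℝ) * s|
    · rw [hd _ h]; simp
    · exact (hC _ (abs_le.1 (not_lt.1 h))).trans (le_max_left _ _)
  · obtain ⟨N, hN⟩ := exists_nat_gt (2 / |s|)
    filter_upwards [eventually_ge_atTop N] with n hn
    have hs' : 0 < |s| := abs_pos.2 hs
    have hn0 : (0:ℝ) < n+1 := by positivity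
    have : 2 < |(n+1 : ℝ) * s| := by
      rw [abs_mul, abs_of_pos hn0, ← div_lt_iff₀ hs']
      have : (N:ℝ) ≤ n := by exact_mod_cast hn
      linarith
    rw [hder, hd _ this, h2 _ this.le]
    exact ⟨by field_simp, rfl⟩

theorem grad_bound {Ω : Set (ℝ × ℝ)} (hΩ : IsOpen Ω) {f : ℝ × ℝ → ℝ}
    (hf : ContDiffOn ℝ 2 f (closure Ω)) {K : Set (ℝ × ℝ)} (hK : IsCompact K) :
    ∃ C, 0 ≤ C ∧ ∀ p ∈ Ω, p ∈ K → ‖fderiv ℝ f p‖ ≤ C ∧ |f p| ≤ C := by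
  have key : ∃ C, ∀ p ∈ Ω, p ∈ K → ‖fderiv ℝ f p‖ ≤ C := by
    refine hK.induction_on (p := fun K => ∃ C, ∀ p ∈ Ω, p ∈ K → ‖fderiv ℝ f p‖ ≤ C)
      ⟨0, by simp⟩ ?_ ?_ ?_
    · rintro s t hst ⟨C, hC⟩
      exact ⟨C, fun p hp hps => hC p hp (hst hps)⟩
    · rintro s t ⟨C, hC⟩ ⟨D, hD⟩
      refine ⟨max C D, fun p hp hps => ?_⟩
      rcases hps with h | h
      · exact (hC p hp h).trans (le_max_left _ _)
      · exact (hD p hp h).trans (le_max_right _ _)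
    · intro x hx
      by_cases hxc : x ∈ closure Ω
      · have h1 : ContDiffWithinAt ℝ (0+1) f (closure Ω) x :=
          (hf x hxc).of_le (by norm_num)
        rw [contDiffWithinAt_succ_iff_hasFDerivWithinAt (by simp)] at h1
        obtain ⟨u, hu, -, f', hf', hc⟩ := h1
        rw [insert_eq_of_mem hxc] at hu
        have hxu : x ∈ u := mem_of_mem_nhdsWithin hxc hu
        have hcw := hc.continuousWithinAt.norm
        have hev : ∀ᶠ y in 𝓝[u] x, ‖f' y‖ < ‖f' x‖ + 1 :=
          hcw.eventually (gt_mem_nhds (by linarith))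
        have hev2 : ∀ᶠ y in 𝓝[closure Ω] x, y ∈ u ∧ ‖f' y‖ < ‖f' x‖ + 1 := by
          have : 𝓝[closure Ω] x ≤ 𝓝[u] x := nhdsWithin_le_of_mem hu
          exact (eventually_mem_set.2 hu).and (this hev)
        rw [eventually_nhdsWithin_iff, eventually_nhds_iff] at hev2
        obtain ⟨V, hV, hVo, hxV⟩ := hev2
        refine ⟨V, mem_nhdsWithin_of_mem_nhds (hVo.mem_nhds hxV), ‖f' x‖ + 1, fun p hp hpV => ?_⟩
        have hpu := hV p hpV (subset_closure hp)
        have hun : u ∈ 𝓝 p := by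
          filter_upwards [hVo.mem_nhds hpV, hΩ.mem_nhds hp] with y hy hy'
          exact (hV y hy (subset_closure hy')).1
        rw [((hf' p hpu.1).hasFDerivAt hun).fderiv]
        exact hpu.2.le
      · refine ⟨(closure Ω)ᶜ, mem_nhdsWithin_of_mem_nhds (isClosed_closure.isOpen_compl.mem_nhds hxc),
          0, fun p hp hp' => (hp' (subset_closure hp)).elim⟩
  obtain ⟨C, hC⟩ := key
  obtain ⟨D, hD⟩ := (hK.inter_right isClosed_closure).exists_bound_of_continuousOn
    (hf.continuousOn.mono inter_subset_right)
  refine ⟨max 0 (max C D), le_max_left _ _, fun p hp hpK => ⟨(hC p hp hpK).trans (by simp), ?_⟩⟩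
  exact (hD p ⟨hpK, subset_closure hp⟩).trans (by simp)

theorem pdx_eq_fderiv {f : ℝ × ℝ → ℝ} {p : ℝ × ℝ} (hf : DifferentiableAt ℝ f p) :
    pdx f p = fderiv ℝ f p (1, 0) := by
  have h1 : HasDerivAt (fun t : ℝ => (t, p.2)) ((1:ℝ), (0:ℝ)) p.1 :=
    (hasDerivAt_id p.1).prodMk (hasDerivAt_const _ _)
  exact (HasFDerivAt.comp_hasDerivAt (f := fun t : ℝ => (t, p.2)) p.1 hf.hasFDerivAt h1).deriv

theorem pdy_eq_fderiv {f : ℝ × ℝ → ℝ} {p : ℝ × ℝ} (hf : DifferentiableAt ℝ f p) :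
    pdy f p = fderiv ℝ f p (0, 1) := by
  have h1 : HasDerivAt (fun t : ℝ => (p.1, t)) ((0:ℝ), (1:ℝ)) p.2 :=
    (hasDerivAt_const _ _).prodMk (hasDerivAt_id p.2)
  exact (HasFDerivAt.comp_hasDerivAt (f := fun t : ℝ => (p.1, t)) p.2 hf.hasFDerivAt h1).deriv

theorem pdx_eq_lineDeriv (f : ℝ × ℝ → ℝ) (p : ℝ × ℝ) :
    pdx f p = lineDeriv ℝ f p (1, 0) := by
  have := deriv_comp_const_add (f := fun t => f (t, p.2)) p.1 0
  simp only [add_zero] at this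
  rw [pdx, ← this, lineDeriv]
  congr 1
  ext t
  congr 1
  ext <;> simp

theorem pdy_eq_lineDeriv (f : ℝ × ℝ → ℝ) (p : ℝ × ℝ) :
    pdy f p = lineDeriv ℝ f p (0, 1) := by
  have := deriv_comp_const_add (f := fun t => f (p.1, t)) p.2 0
  simp only [add_zero] at this
  rw [pdy, ← this, lineDeriv]
  congr 1
  ext t
  congr 1
  ext <;> simp

theorem countable_level (f : ℝ → ℝ) : {t | f t = 0 ∧ deriv f t ≠ 0}.Countable := by
  refine (countable_setOfPred_isolated_right_within (s := {t | f t = 0})).mono ?_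
  rintro t ⟨h0, h1⟩
  have hd := (differentiableAt_of_deriv_ne_zero h1).hasDerivAt
  have := (hd.eventually_ne (c := 0) h1).filter_mono
    (nhdsWithin_mono t (show Ioi t ⊆ {t}ᶜ from fun y hy => ne_of_gt hy))
  refine ⟨h0, ?_⟩
  rw [inter_comm, nhdsWithin_inter', inf_principal_eq_bot]
  exact this

theorem ae_level {Ω : Set (ℝ × ℝ)} (hΩ : IsOpen Ω) {h : ℝ × ℝ → ℝ} (hc : ContinuousOn h Ω)
    (hx : ContinuousOn (pdx h) Ω) (hy : ContinuousOn (pdy h) Ω) :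
    ∀ᵐ p ∂(volume.restrict Ω), h p = 0 → pdx h p = 0 ∧ pdy h p = 0 := by
  have meas : ∀ g : ℝ × ℝ → ℝ, ContinuousOn g Ω →
      MeasurableSet {p | p ∈ Ω ∧ h p = 0 ∧ g p ≠ 0} := by
    intro g hg
    have h1 : MeasurableSet (Ω ∩ g ⁻¹' {0}ᶜ) :=
      (hg.isOpen_inter_preimage hΩ isOpen_compl_singleton).measurableSet
    have h2 : MeasurableSet (Ω ∩ h ⁻¹' {0}ᶜ) :=
      (hc.isOpen_inter_preimage hΩ isOpen_compl_singleton).measurableSet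
    convert h1.diff h2 using 1
    ext p
    simp
    tauto
  have n1 : volume {p : ℝ × ℝ | p ∈ Ω ∧ h p = 0 ∧ pdx h p ≠ 0} = 0 := by
    rw [Measure.volume_eq_prod, Measure.prod_apply_symm (meas _ hx), lintegral_eq_zero_iff']
    · refine Eventually.of_forall fun y => ?_
      refine ((countable_level fun t => h (t, y)).mono ?_).measure_zero _
      rintro t ⟨-, h1, h2⟩
      exact ⟨h1, h2⟩
    · exact (measurable_measure_prodMk_right (meas _ hx)).aemeasurable
  have n2 : volume {p : ℝ × ℝ | p ∈ Ω ∧ h p = 0 ∧ pdy h p ≠ 0} = 0 := by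
    rw [Measure.volume_eq_prod, Measure.measure_prod_null (meas _ hy)]
    refine Eventually.of_forall fun x => ?_
    refine ((countable_level fun t => h (x, t)).mono ?_).measure_zero _
    rintro t ⟨-, h1, h2⟩
    exact ⟨h1, h2⟩
  rw [ae_restrict_iff' hΩ.measurableSet]
  have a1 := measure_eq_zero_iff_ae_notMem.1 n1
  have a2 := measure_eq_zero_iff_ae_notMem.1 n2
  filter_upwards [a1, a2] with p h1 h2 hp h0
  simp only [not_and, not_not] at h1 h2
  exact ⟨h1 hp h0, h2 hp h0⟩

theorem ibp {G ζ : ℝ × ℝ → ℝ} (hG : ContDiff ℝ 1 G) {K : NNReal} (hζ : LipschitzWith K ζ)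
    (hζc : HasCompactSupport ζ) (v : ℝ × ℝ) :
    Integrable (fun p => fderiv ℝ G p v * ζ p ^ 2) ∧
    Integrable (fun p => 2 * ζ p * lineDeriv ℝ ζ p v * G p) ∧
    ∫ p, fderiv ℝ G p v * ζ p ^ 2 = - ∫ p, 2 * ζ p * lineDeriv ℝ ζ p v * G p := by
  have hζ2c : HasCompactSupport (fun p => ζ p ^ 2) := by
    have := hζc.comp_left (g := fun x : ℝ => x ^ 2) (by simp)
    exact this
  refine ⟨?_, ?_, ?_⟩
  · apply Continuous.integrable_of_hasCompactSupport
    · have := (hG.continuous_fderiv one_ne_zero)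
      have h2 := hζ.continuous
      fun_prop
    · exact hζ2c.mul_left
  · have h1 : Integrable (fun p => (2 * ζ p * G p)) := by
      apply Continuous.integrable_of_hasCompactSupport
      · have := hG.continuous
        have h2 := hζ.continuous
        fun_prop
      · exact (hζc.mul_left (f := fun _ => (2:ℝ))).mul_right
    have h2 := h1.bdd_mul (c := K * ‖v‖)
      (measurable_lineDeriv (𝕜 := ℝ) (v := v) hζ.continuous).aestronglyMeasurable
      (Eventually.of_forall fun p => norm_lineDeriv_le_of_lipschitz ℝ hζ)
    refine h2.congr (Eventually.of_forall fun p => ?_)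
    simp only
    ring
  · obtain ⟨R, hR0, hR⟩ := hζc.isCompact.isBounded.subset_ball_lt 0 0
    let b : ContDiffBump (0 : ℝ × ℝ) := ⟨R, R + 1, hR0, by linarith⟩
    have hb1 : ∀ p, ζ p ≠ 0 → (fun q => b q * G q) =ᶠ[𝓝 p] G := by
      intro p hp
      have : p ∈ Metric.ball (0 : ℝ × ℝ) R := hR (subset_tsupport _ hp)
      filter_upwards [Metric.isOpen_ball.mem_nhds this] with q hq
      rw [b.one_of_mem_closedBall (Metric.ball_subset_closedBall hq), one_mul]
    have hbG : ContDiff ℝ 1 (fun q => b q * G q) := b.contDiff.mul hG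
    obtain ⟨C, hC⟩ := ContDiff.lipschitzWith_of_hasCompactSupport
      (b.hasCompactSupport.mul_right (f' := G)) hbG one_ne_zero
    obtain ⟨B, hB⟩ := hζc.exists_bound_of_continuous hζ.continuous
    have hB0 : 0 ≤ B := (norm_nonneg _).trans (hB 0)
    have hζ2 : LipschitzWith (2 * B.toNNReal * K) (fun p => ζ p ^ 2) := by
      refine LipschitzWith.of_dist_le_mul fun p q => ?_
      have h1 := hζ.dist_le_mul p q
      rw [Real.dist_eq] at h1 ⊢
      have : ζ p ^ 2 - ζ q ^ 2 = (ζ p + ζ q) * (ζ p - ζ q) := by ring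
      rw [this, abs_mul]
      have h2 : |ζ p + ζ q| ≤ 2 * B :=
        (abs_add_le _ _).trans (by have := hB p; have := hB q; simp only [Real.norm_eq_abs] at *; linarith)
      push_cast
      rw [Real.coe_toNNReal _ hB0, mul_assoc (2 * B)]
      exact mul_le_mul h2 h1 (abs_nonneg _) (by positivity)
    have key := hC.integral_lineDeriv_mul_eq (μ := volume) hζ2 hζ2c v
    calc ∫ p, fderiv ℝ G p v * ζ p ^ 2
        = ∫ p, lineDeriv ℝ (fun q => b q * G q) p v * ζ p ^ 2 := by
          congr 1
          ext p
          by_cases hp : ζ p = 0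
          · simp [hp]
          · rw [((hbG.differentiable one_ne_zero) p).lineDeriv_eq_fderiv, (hb1 p hp).fderiv_eq]
      _ = _ := key
      _ = _ := by
          rw [← integral_neg]
          refine integral_congr_ae ?_
          filter_upwards [hζ.ae_lineDifferentiableAt (μ := volume) v] with p hp
          rw [lineDeriv_neg]
          have : lineDeriv ℝ (fun p => ζ p ^ 2) p v = 2 * ζ p * lineDeriv ℝ ζ p v := by
            have h1 : HasDerivAt (fun t : ℝ => ζ (p + t • v)) (lineDeriv ℝ ζ p v) 0 :=
              hp.hasLineDerivAt
            have h2 := h1.pow 2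
            refine (HasDerivAt.deriv h2).trans ?_
            simp
          rw [this]
          by_cases hp : ζ p = 0
          · simp [hp]
          · have h3 : (b * G) p = G p := (hb1 p hp).eq_of_nhds
            rw [h3]
            ring

theorem contDiff_indicator {Ω A : Set (ℝ × ℝ)} (hΩ : IsOpen Ω) (hA : IsClosed A) (hAΩ : A ⊆ Ω)
    {g : ℝ × ℝ → ℝ} (hg : ContDiffOn ℝ 1 g Ω) (h0 : ∀ p ∈ Ω, p ∉ A → g p = 0) :
    ContDiff ℝ 1 (Ω.indicator g) := by
  rw [contDiff_iff_contDiffAt]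
  intro p
  by_cases hp : p ∈ Ω
  · refine (hg.contDiffAt (hΩ.mem_nhds hp)).congr_of_eventuallyEq ?_
    filter_upwards [hΩ.mem_nhds hp] with q hq
    exact indicator_of_mem hq _
  · refine (contDiffAt_const (c := (0:ℝ))).congr_of_eventuallyEq ?_
    filter_upwards [hA.isOpen_compl.mem_nhds (fun h => hp (hAΩ h))] with q hq
    by_cases hqΩ : q ∈ Ω
    · rw [indicator_of_mem hqΩ, h0 q hqΩ hq]
    · exact indicator_of_notMem hqΩ _

/-- Pointwise computation of the divergence. -/
theorem div_formula {ψ h : ℝ × ℝ → ℝ} {S : ℝ → ℝ} {p : ℝ × ℝ}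
    (hψ : DifferentiableAt ℝ ψ p) (hh : DifferentiableAt ℝ h p)
    (hx : DifferentiableAt ℝ (pdx h) p) (hy : DifferentiableAt ℝ (pdy h) p)
    (hS : DifferentiableAt ℝ S (h p * ψ p)) (hpos : 0 < ψ p)
    (hdiv : pdx (fun q => ψ q ^ 2 * pdx h q) p + pdy (fun q => ψ q ^ 2 * pdy h q) p = 0) :
    fderiv ℝ (fun q => S (h q * ψ q) * ψ q * pdx h q) p (1, 0)
      + fderiv ℝ (fun q => S (h q * ψ q) * ψ q * pdy h q) p (0, 1)
    = deriv S (h p * ψ p) * (pdx h p ^ 2 + pdy h p ^ 2) * ψ p ^ 2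
      + (deriv S (h p * ψ p) * (h p * ψ p) - S (h p * ψ p))
        * (pdx ψ p * pdx h p + pdy ψ p * pdy h p) := by
  have hφ := hh.hasFDerivAt.mul hψ.hasFDerivAt
  have hSφ := HasDerivAt.comp_hasFDerivAt p hS.hasDerivAt hφ
  have e1 := ((hSφ.mul hψ.hasFDerivAt).mul hx.hasFDerivAt).fderiv
  have e2 := ((hSφ.mul hψ.hasFDerivAt).mul hy.hasFDerivAt).fderiv
  have d1 := ((hψ.hasFDerivAt.pow 2).mul hx.hasFDerivAt)
  have d2 := ((hψ.hasFDerivAt.pow 2).mul hy.hasFDerivAt)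
  have f1 : pdx (fun q => ψ q ^ 2 * pdx h q) p = _ :=
    (pdx_eq_fderiv d1.differentiableAt).trans (congrArg (· (1, 0)) d1.fderiv)
  have f2 : pdy (fun q => ψ q ^ 2 * pdy h q) p = _ :=
    (pdy_eq_fderiv d2.differentiableAt).trans (congrArg (· (0, 1)) d2.fderiv)
  rw [f1, f2] at hdiv
  have e1' : fderiv ℝ (fun q => S (h q * ψ q) * ψ q * pdx h q) p (1, 0) = _ :=
    congrArg (· (1, 0)) e1
  have e2' : fderiv ℝ (fun q => S (h q * ψ q) * ψ q * pdy h q) p (0, 1) = _ :=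
    congrArg (· (0, 1)) e2
  rw [e1', e2']
  simp only [add_apply, smul_apply, smul_eq_mul,
    Function.comp_apply, Pi.mul_apply, nsmul_eq_mul,
    ← pdx_eq_fderiv hψ, ← pdx_eq_fderiv hh, ← pdy_eq_fderiv hψ, ← pdy_eq_fderiv hh] at hdiv ⊢
  have hd : ψ p * (fderiv ℝ (pdx h) p (1, 0) + fderiv ℝ (pdy h) p (0, 1))
      = - 2 * (pdx ψ p * pdx h p + pdy ψ p * pdy h p) := by
    apply mul_left_cancel₀ hpos.ne'
    norm_num at hdiv
    linear_combination hdiv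
  linear_combination S (h p * ψ p) * hd

/-- Caccioppoli-type inequality: if `div(ψ²∇h) = 0` on `Ω`, `ψ > 0`,
`φ = hψ` vanishes on `∂Ω` and `ζ` is a compactly supported Lipschitz cutoff, then
`∫_Ω |∇h|²ψ²ζ² ≤ 2 (∫_Ω |∇h|²ψ²ζ²)^{1/2} (∫_Ω φ²|∇ζ|²)^{1/2}`, hence
`∫_Ω |∇h|²ψ²ζ² ≤ 4 ∫_Ω φ²|∇ζ|²`. -/
theorem caccioppoli_inequality
    (Ω : Set (ℝ × ℝ)) (hΩ : IsOpen Ω)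
    (ψ h : ℝ × ℝ → ℝ)
    (hψ : ContDiffOn ℝ 2 ψ (closure Ω)) (hh : ContDiffOn ℝ 2 h (closure Ω))
    (hψpos : ∀ p ∈ Ω, 0 < ψ p)
    (hdiv : ∀ p ∈ Ω,
      pdx (fun q => ψ q ^ 2 * pdx h q) p + pdy (fun q => ψ q ^ 2 * pdy h q) p = 0)
    (φ : ℝ × ℝ → ℝ) (hφ : ∀ p, φ p = h p * ψ p)
    (hbd : ∀ p ∈ frontier Ω, φ p = 0)
    (ζ : ℝ × ℝ → ℝ) (K : NNReal) (hζ : LipschitzWith K ζ)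
    (hζc : HasCompactSupport ζ) :
    (∫ p in Ω, ((pdx h p) ^ 2 + (pdy h p) ^ 2) * ψ p ^ 2 * ζ p ^ 2)
        ≤ 2 * Real.sqrt (∫ p in Ω, ((pdx h p) ^ 2 + (pdy h p) ^ 2) * ψ p ^ 2 * ζ p ^ 2)
            * Real.sqrt (∫ p in Ω, φ p ^ 2 * ((pdx ζ p) ^ 2 + (pdy ζ p) ^ 2)) ∧
    (∫ p in Ω, ((pdx h p) ^ 2 + (pdy h p) ^ 2) * ψ p ^ 2 * ζ p ^ 2)
        ≤ 4 * ∫ p in Ω, φ p ^ 2 * ((pdx ζ p) ^ 2 + (pdy ζ p) ^ 2) := by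
  have hψΩ : ContDiffOn ℝ 2 ψ Ω := hψ.mono subset_closure
  have hhΩ : ContDiffOn ℝ 2 h Ω := hh.mono subset_closure
  have hψd : ∀ p ∈ Ω, DifferentiableAt ℝ ψ p := fun p hp =>
    (hψΩ.contDiffAt (hΩ.mem_nhds hp)).differentiableAt two_ne_zero
  have hhd : ∀ p ∈ Ω, DifferentiableAt ℝ h p := fun p hp =>
    (hhΩ.contDiffAt (hΩ.mem_nhds hp)).differentiableAt two_ne_zero
  have cx : ∀ {f : ℝ × ℝ → ℝ}, ContDiffOn ℝ 2 f Ω → ContDiffOn ℝ 1 (pdx f) Ω := fun {f} hf =>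
    ((hf.fderiv_of_isOpen hΩ (m := 1) (by norm_num)).clm_apply
      (contDiffOn_const (c := ((1:ℝ), (0:ℝ))))).congr fun p hp =>
        pdx_eq_fderiv ((hf.contDiffAt (hΩ.mem_nhds hp)).differentiableAt two_ne_zero)
  have cy : ∀ {f : ℝ × ℝ → ℝ}, ContDiffOn ℝ 2 f Ω → ContDiffOn ℝ 1 (pdy f) Ω := fun {f} hf =>
    ((hf.fderiv_of_isOpen hΩ (m := 1) (by norm_num)).clm_apply
      (contDiffOn_const (c := ((0:ℝ), (1:ℝ))))).congr fun p hp =>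
        pdy_eq_fderiv ((hf.contDiffAt (hΩ.mem_nhds hp)).differentiableAt two_ne_zero)
  have dx : ∀ p ∈ Ω, DifferentiableAt ℝ (pdx h) p := fun p hp =>
    ((cx hhΩ).contDiffAt (hΩ.mem_nhds hp)).differentiableAt one_ne_zero
  have dy : ∀ p ∈ Ω, DifferentiableAt ℝ (pdy h) p := fun p hp =>
    ((cy hhΩ).contDiffAt (hΩ.mem_nhds hp)).differentiableAt one_ne_zero
  obtain ⟨T, CT, hT1, hT0, hTle, hTd, hTlim⟩ := exists_trunc
  -- uniform bounds
  obtain ⟨M, hM0, hM⟩ : ∃ M : ℝ, 0 ≤ M ∧ ∀ p ∈ Ω, p ∈ tsupport ζ → |h p| ≤ M ∧ |ψ p| ≤ M ∧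
      |pdx h p| ≤ M ∧ |pdy h p| ≤ M ∧ |pdx ψ p| ≤ M ∧ |pdy ψ p| ≤ M ∧ |ζ p| ≤ M ∧
      |pdx ζ p| ≤ M ∧ |pdy ζ p| ≤ M ∧ ∀ n s, |deriv (T n) s| ≤ M := by
    obtain ⟨C1, hC1, b1⟩ := grad_bound hΩ hh hζc.isCompact
    obtain ⟨C2, hC2, b2⟩ := grad_bound hΩ hψ hζc.isCompact
    obtain ⟨B, hB⟩ := hζc.exists_bound_of_continuous hζ.continuous
    have hB0 : 0 ≤ B := (norm_nonneg _).trans (hB 0)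
    have hCT : 0 ≤ CT := (abs_nonneg _).trans (hTd 0 0)
    have hK := K.coe_nonneg
    have n1 : ‖((1:ℝ), (0:ℝ))‖ = 1 := by simp [Prod.norm_def]
    have n2 : ‖((0:ℝ), (1:ℝ))‖ = 1 := by simp [Prod.norm_def]
    refine ⟨C1 + C2 + B + K + CT, by positivity, fun p hp hpK => ?_⟩
    obtain ⟨g1, v1⟩ := b1 p hp hpK
    obtain ⟨g2, v2⟩ := b2 p hp hpK
    have ex : ∀ L : ℝ × ℝ →L[ℝ] ℝ, |L (1, 0)| ≤ ‖L‖ := fun L => by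
      simpa [n1] using L.le_opNorm (1, 0)
    have ey : ∀ L : ℝ × ℝ →L[ℝ] ℝ, |L (0, 1)| ≤ ‖L‖ := fun L => by
      simpa [n2] using L.le_opNorm (0, 1)
    have z1 : |pdx ζ p| ≤ K := by
      rw [pdx_eq_lineDeriv]
      simpa [n1] using norm_lineDeriv_le_of_lipschitz ℝ hζ (x₀ := p) (v := ((1:ℝ), (0:ℝ)))
    have z2 : |pdy ζ p| ≤ K := by
      rw [pdy_eq_lineDeriv]
      simpa [n2] using norm_lineDeriv_le_of_lipschitz ℝ hζ (x₀ := p) (v := ((0:ℝ), (1:ℝ)))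
    have hz : |ζ p| ≤ B := hB p
    rw [pdx_eq_fderiv (hhd p hp), pdy_eq_fderiv (hhd p hp), pdx_eq_fderiv (hψd p hp),
      pdy_eq_fderiv (hψd p hp)]
    have q1 := ex (fderiv ℝ h p)
    have q2 := ey (fderiv ℝ h p)
    have q3 := ex (fderiv ℝ ψ p)
    have q4 := ey (fderiv ℝ ψ p)
    refine ⟨?_, ?_, ?_, ?_, ?_, ?_, ?_, ?_, ?_, fun n s => ?_⟩
    on_goal 10 => have q5 := hTd n s
    all_goals linarith
  -- measurability
  have mΩ := hΩ.measurableSet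
  have mh : AEStronglyMeasurable h (volume.restrict Ω) := hhΩ.continuousOn.aestronglyMeasurable mΩ
  have mψ : AEStronglyMeasurable ψ (volume.restrict Ω) := hψΩ.continuousOn.aestronglyMeasurable mΩ
  have mhx : AEStronglyMeasurable (pdx h) (volume.restrict Ω) :=
    (cx hhΩ).continuousOn.aestronglyMeasurable mΩ
  have mhy : AEStronglyMeasurable (pdy h) (volume.restrict Ω) :=
    (cy hhΩ).continuousOn.aestronglyMeasurable mΩ
  have mψx : AEStronglyMeasurable (pdx ψ) (volume.restrict Ω) :=
    (cx hψΩ).continuousOn.aestronglyMeasurable mΩ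
  have mψy : AEStronglyMeasurable (pdy ψ) (volume.restrict Ω) :=
    (cy hψΩ).continuousOn.aestronglyMeasurable mΩ
  have mζ : AEStronglyMeasurable ζ (volume.restrict Ω) := hζ.continuous.aestronglyMeasurable
  have mζx : AEStronglyMeasurable (pdx ζ) (volume.restrict Ω) := by
    rw [funext (pdx_eq_lineDeriv ζ)]
    exact (measurable_lineDeriv hζ.continuous).aestronglyMeasurable
  have mζy : AEStronglyMeasurable (pdy ζ) (volume.restrict Ω) := by
    rw [funext (pdy_eq_lineDeriv ζ)]
    exact (measurable_lineDeriv hζ.continuous).aestronglyMeasurable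
  have mT : ∀ n, AEStronglyMeasurable (fun p => T n (h p * ψ p)) (volume.restrict Ω) := fun n =>
    (hT1 n).continuous.comp_aestronglyMeasurable (mh.mul mψ)
  have mT' : ∀ n, AEStronglyMeasurable (fun p => deriv (T n) (h p * ψ p)) (volume.restrict Ω) :=
    fun n => ((hT1 n).continuous_deriv le_rfl).comp_aestronglyMeasurable (mh.mul mψ)
  have hvol : volume (tsupport ζ) < ⊤ := hζc.isCompact.measure_lt_top
  have hKm : MeasurableSet (tsupport ζ) := (isClosed_tsupport ζ).measurableSet
  have bint : ∀ c : ℝ, Integrable ((tsupport ζ).indicator fun _ => c) (volume.restrict Ω) :=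
    fun c => ((integrable_indicator_iff hKm).2 (integrableOn_const hvol.ne)).restrict
  have bbd : ∀ (F : ℝ × ℝ → ℝ) (c : ℝ), (∀ p ∈ Ω, p ∈ tsupport ζ → |F p| ≤ c) →
      (∀ p, p ∉ tsupport ζ → F p = 0) →
      ∀ᵐ p ∂(volume.restrict Ω), ‖F p‖ ≤ (tsupport ζ).indicator (fun _ => c) p := by
    intro F c h1 h2
    filter_upwards [ae_restrict_mem mΩ] with p hp
    by_cases hpK : p ∈ tsupport ζ
    · rw [indicator_of_mem hpK]; exact h1 p hp hpK
    · rw [indicator_of_notMem hpK, h2 p hpK, norm_zero]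
  have hζ0 : ∀ p, p ∉ tsupport ζ → ζ p = 0 := fun p hp => image_eq_zero_of_notMem_tsupport hp
  have hζx0 : ∀ p, p ∉ tsupport ζ → pdx ζ p = 0 ∧ pdy ζ p = 0 := by
    intro p hp
    have he : ζ =ᶠ[𝓝 p] fun _ => (0:ℝ) := notMem_tsupport_iff_eventuallyEq.1 hp
    have hd : DifferentiableAt ℝ ζ p := (differentiableAt_const _).congr_of_eventuallyEq he
    rw [pdx_eq_fderiv hd, pdy_eq_fderiv hd, he.fderiv_eq]
    simp
  -- the integrands
  let A : ℝ × ℝ → ℝ := fun p => (pdx h p ^ 2 + pdy h p ^ 2) * ψ p ^ 2 * ζ p ^ 2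
  let Bf : ℝ × ℝ → ℝ := fun p => φ p ^ 2 * (pdx ζ p ^ 2 + pdy ζ p ^ 2)
  let J : ℝ × ℝ → ℝ := fun p =>
    2 * ζ p * (h p * ψ p) * ψ p * (pdx h p * pdx ζ p + pdy h p * pdy ζ p)
  let In : ℕ → ℝ × ℝ → ℝ := fun n p =>
    (deriv (T n) (h p * ψ p) * (pdx h p ^ 2 + pdy h p ^ 2) * ψ p ^ 2
      + (deriv (T n) (h p * ψ p) * (h p * ψ p) - T n (h p * ψ p))
        * (pdx ψ p * pdx h p + pdy ψ p * pdy h p)) * ζ p ^ 2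
  let Jn : ℕ → ℝ × ℝ → ℝ := fun n p =>
    2 * ζ p * T n (h p * ψ p) * ψ p * (pdx h p * pdx ζ p + pdy h p * pdy ζ p)
  have mIn : ∀ n, AEStronglyMeasurable (In n) (volume.restrict Ω) := fun n => by
    have := mT n
    have := mT' n
    fun_prop
  have mJn : ∀ n, AEStronglyMeasurable (Jn n) (volume.restrict Ω) := fun n => by
    have := mT n
    fun_prop
  have bT : ∀ n p, p ∈ Ω → p ∈ tsupport ζ → |T n (h p * ψ p)| ≤ M * M := by
    intro n p hp hpK
    obtain ⟨b1, b2, -⟩ := hM p hp hpK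
    refine (hTle _ _).trans ?_
    rw [abs_mul]
    gcongr
  have bIn : ∀ n, ∀ p ∈ Ω, p ∈ tsupport ζ → |In n p| ≤
      (M * (M ^ 2 + M ^ 2) * M ^ 2 + (M * (M * M) + M * M) * (M * M + M * M)) * M ^ 2 := by
    intro n p hp hpK
    obtain ⟨b1, b2, b3, b4, b5, b6, b7, b8, b9, b10⟩ := hM p hp hpK
    have b11 := bT n p hp hpK
    have b12 := b10 n (h p * ψ p)
    have sq : ∀ {x : ℝ}, |x| ≤ M → |x ^ 2| ≤ M ^ 2 := fun {x} hx => by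
      rw [abs_pow]; gcongr
    have ml : ∀ {x y a b : ℝ}, |x| ≤ a → |y| ≤ b → |x * y| ≤ a * b := fun {x y a b} hx hy => by
      rw [abs_mul]; exact mul_le_mul hx hy (abs_nonneg _) ((abs_nonneg _).trans hx)
    have ad : ∀ {x y a b : ℝ}, |x| ≤ a → |y| ≤ b → |x + y| ≤ a + b := fun {x y a b} hx hy =>
      (abs_add_le _ _).trans (add_le_add hx hy)
    have sb : ∀ {x y a b : ℝ}, |x| ≤ a → |y| ≤ b → |x - y| ≤ a + b := fun {x y a b} hx hy =>
      (abs_sub _ _).trans (add_le_add hx hy)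
    exact ml (ad (ml (ml b12 (ad (sq b3) (sq b4))) (sq b2))
      (ml (sb (ml b12 (ml b1 b2)) b11) (ad (ml b5 b3) (ml b6 b4)))) (sq b7)
  have bJn : ∀ n, ∀ p ∈ Ω, p ∈ tsupport ζ → |Jn n p| ≤
      2 * M * (M * M) * M * (M * M + M * M) := by
    intro n p hp hpK
    obtain ⟨b1, b2, b3, b4, b5, b6, b7, b8, b9, b10⟩ := hM p hp hpK
    have b11 := bT n p hp hpK
    have ml : ∀ {x y a b : ℝ}, |x| ≤ a → |y| ≤ b → |x * y| ≤ a * b := fun {x y a b} hx hy => by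
      rw [abs_mul]; exact mul_le_mul hx hy (abs_nonneg _) ((abs_nonneg _).trans hx)
    have ad : ∀ {x y a b : ℝ}, |x| ≤ a → |y| ≤ b → |x + y| ≤ a + b := fun {x y a b} hx hy =>
      (abs_add_le _ _).trans (add_le_add hx hy)
    exact ml (ml (ml (ml (by simp) b7) b11) b2) (ad (ml b3 b8) (ml b4 b9))
  have bA : ∀ p ∈ Ω, p ∈ tsupport ζ → |A p| ≤ (M ^ 2 + M ^ 2) * M ^ 2 * M ^ 2 := by
    intro p hp hpK
    obtain ⟨b1, b2, b3, b4, b5, b6, b7, b8, b9, b10⟩ := hM p hp hpK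
    have sq : ∀ {x : ℝ}, |x| ≤ M → x ^ 2 ≤ M ^ 2 := fun {x} hx => by
      rw [← sq_abs]; gcongr
    rw [abs_of_nonneg (by positivity)]
    have := sq b3
    have := sq b4
    have := sq b2
    have := sq b7
    simp only [A]
    gcongr
  have bB : ∀ p ∈ Ω, p ∈ tsupport ζ → |Bf p| ≤ (M * M) ^ 2 * (M ^ 2 + M ^ 2) := by
    intro p hp hpK
    obtain ⟨b1, b2, b3, b4, b5, b6, b7, b8, b9, b10⟩ := hM p hp hpK
    have sq : ∀ {x : ℝ}, |x| ≤ M → x ^ 2 ≤ M ^ 2 := fun {x} hx => by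
      rw [← sq_abs]; gcongr
    rw [abs_of_nonneg (by positivity)]
    have := sq b8
    have := sq b9
    have : φ p ^ 2 ≤ (M * M) ^ 2 := by
      rw [hφ, ← sq_abs, abs_mul]; gcongr
    simp only [Bf]
    gcongr
  have iA : Integrable A (volume.restrict Ω) := by
    refine (bint _).mono' (by fun_prop) (bbd A _ bA fun p hp => ?_)
    simp [A, hζ0 p hp]
  have iB : Integrable Bf (volume.restrict Ω) := by
    have mφ : AEStronglyMeasurable φ (volume.restrict Ω) := by
      rw [funext hφ]; exact mh.mul mψ
    refine (bint _).mono' (by fun_prop) (bbd Bf _ bB fun p hp => ?_)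
    simp [Bf, hζx0 p hp]
  -- the identity for the truncations
  have ident : ∀ n, ∫ p in Ω, In n p = - ∫ p in Ω, Jn n p := by
    intro n
    obtain ⟨ε, hε, hTε⟩ := hT0 n
    let S : Set (ℝ × ℝ) := closure Ω ∩ (fun p => h p * ψ p) ⁻¹' {s | ε ≤ |s|}
    have hS : IsClosed S := by
      refine ContinuousOn.preimage_isClosed_of_isClosed (hh.continuousOn.mul hψ.continuousOn)
        isClosed_closure ?_
      exact isClosed_le continuous_const continuous_abs
    have hSΩ : S ⊆ Ω := by
      rintro p ⟨hp, hpε⟩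
      by_contra hpΩ
      have : φ p = 0 := hbd p (by rw [hΩ.frontier_eq]; exact ⟨hp, hpΩ⟩)
      rw [hφ] at this
      have hpε' : ε ≤ |h p * ψ p| := hpε
      rw [this, abs_zero] at hpε'
      linarith
    have hT0' : ∀ p ∈ Ω, p ∉ S → T n (h p * ψ p) = 0 := by
      intro p hp hpS
      apply hTε
      by_contra hcon
      exact hpS ⟨subset_closure hp, not_lt.1 hcon⟩
    let g1 : ℝ × ℝ → ℝ := fun q => T n (h q * ψ q) * ψ q * pdx h q
    let g2 : ℝ × ℝ → ℝ := fun q => T n (h q * ψ q) * ψ q * pdy h q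
    have hψ1 : ContDiffOn ℝ 1 ψ Ω := hψΩ.of_le (by norm_num)
    have hh1 : ContDiffOn ℝ 1 h Ω := hhΩ.of_le (by norm_num)
    have hTc : ContDiffOn ℝ 1 (fun q => T n (h q * ψ q)) Ω := (hT1 n).comp_contDiffOn (hh1.mul hψ1)
    have cg1 : ContDiff ℝ 1 (Ω.indicator g1) :=
      contDiff_indicator hΩ hS hSΩ ((hTc.mul hψ1).mul (cx hhΩ)) fun p hp hpS => by
        simp [g1, hT0' p hp hpS]
    have cg2 : ContDiff ℝ 1 (Ω.indicator g2) :=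
      contDiff_indicator hΩ hS hSΩ ((hTc.mul hψ1).mul (cy hhΩ)) fun p hp hpS => by
        simp [g2, hT0' p hp hpS]
    obtain ⟨i1, j1, e1⟩ := ibp cg1 hζ hζc (1, 0)
    obtain ⟨i2, j2, e2⟩ := ibp cg2 hζ hζc (0, 1)
    have hin : ∀ (g : ℝ × ℝ → ℝ) p, p ∈ Ω → Ω.indicator g =ᶠ[𝓝 p] g := fun g p hp => by
      filter_upwards [hΩ.mem_nhds hp] with q hq
      exact indicator_of_mem hq _
    have hout : ∀ (g : ℝ × ℝ → ℝ), (∀ p ∈ Ω, p ∉ S → g p = 0) → ∀ p, p ∉ Ω →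
        fderiv ℝ (Ω.indicator g) p = 0 := fun g hg p hp => by
      have : Ω.indicator g =ᶠ[𝓝 p] fun _ => (0:ℝ) := by
        filter_upwards [hS.isOpen_compl.mem_nhds (fun h => hp (hSΩ h))] with q hq
        by_cases hqΩ : q ∈ Ω
        · rw [indicator_of_mem hqΩ, hg q hqΩ hq]
        · exact indicator_of_notMem hqΩ _
      rw [this.fderiv_eq]; simp
    have L : ∫ p in Ω, In n p = ∫ p, (fderiv ℝ (Ω.indicator g1) p (1, 0) * ζ p ^ 2
        + fderiv ℝ (Ω.indicator g2) p (0, 1) * ζ p ^ 2) := by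
      refine Eq.trans ?_ (setIntegral_eq_integral_of_forall_compl_eq_zero (s := Ω) ?_)
      · refine setIntegral_congr_fun mΩ fun p hp => ?_
        have := div_formula (S := T n) (hψd p hp) (hhd p hp) (dx p hp) (dy p hp)
          ((hT1 n).differentiable one_ne_zero _) (hψpos p hp) (hdiv p hp)
        simp only [In]
        rw [(hin g1 p hp).fderiv_eq, (hin g2 p hp).fderiv_eq, ← this, add_mul]
      · intro p hp
        rw [hout g1 (fun p hp hpS => by simp [g1, hT0' p hp hpS]) p hp,
          hout g2 (fun p hp hpS => by simp [g2, hT0' p hp hpS]) p hp]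
        simp
    have R : ∫ p in Ω, Jn n p = ∫ p, (2 * ζ p * lineDeriv ℝ ζ p (1, 0) * Ω.indicator g1 p
        + 2 * ζ p * lineDeriv ℝ ζ p (0, 1) * Ω.indicator g2 p) := by
      refine Eq.trans ?_ (setIntegral_eq_integral_of_forall_compl_eq_zero (s := Ω) ?_)
      · refine setIntegral_congr_fun mΩ fun p hp => ?_
        simp only [Jn, g1, g2]
        rw [indicator_of_mem hp, indicator_of_mem hp, ← pdx_eq_lineDeriv, ← pdy_eq_lineDeriv]
        ring
      · intro p hp
        rw [indicator_of_notMem hp, indicator_of_notMem hp]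
        simp
    rw [L, R, integral_add i1 i2, integral_add j1 j2, e1, e2]
    ring
  -- passing to the limit
  have hlev := ae_level hΩ hhΩ.continuousOn (cx hhΩ).continuousOn (cy hhΩ).continuousOn
  have limI : Tendsto (fun n => ∫ p in Ω, In n p) atTop (𝓝 (∫ p in Ω, A p)) := by
    refine tendsto_integral_of_dominated_convergence _ mIn (bint _)
      (fun n => bbd (In n) _ (bIn n) fun p hp => by simp [In, hζ0 p hp]) ?_
    filter_upwards [hlev, ae_restrict_mem mΩ] with p hp hpΩ
    refine tendsto_const_nhds.congr' ?_
    by_cases h0 : h p = 0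
    · obtain ⟨z1, z2⟩ := hp h0
      exact Eventually.of_forall fun n => by simp [A, In, z1, z2]
    · filter_upwards [hTlim _ (mul_ne_zero h0 (hψpos p hpΩ).ne')] with n hn
      simp only [A, In, hn.1, hn.2]
      ring
  have limJ : Tendsto (fun n => ∫ p in Ω, Jn n p) atTop (𝓝 (∫ p in Ω, J p)) := by
    refine tendsto_integral_of_dominated_convergence _ mJn (bint _)
      (fun n => bbd (Jn n) _ (bJn n) fun p hp => by simp [Jn, hζ0 p hp]) ?_
    filter_upwards [hlev, ae_restrict_mem mΩ] with p hp hpΩ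
    refine tendsto_const_nhds.congr' ?_
    by_cases h0 : h p = 0
    · obtain ⟨z1, z2⟩ := hp h0
      exact Eventually.of_forall fun n => by simp [J, Jn, z1, z2]
    · filter_upwards [hTlim _ (mul_ne_zero h0 (hψpos p hpΩ).ne')] with n hn
      simp only [J, Jn, hn.1]
  have hAJ : ∫ p in Ω, A p = ∫ p in Ω, - J p := by
    rw [integral_neg]
    refine tendsto_nhds_unique limI ?_
    simp_rw [ident]
    exact limJ.neg
  have hle : ∫ p in Ω, - J p ≤ ∫ p in Ω, ((1/2) * A p + 2 * Bf p) := by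
    have mJ : AEStronglyMeasurable J (volume.restrict Ω) := by fun_prop
    have hpt : ∀ (p : ℝ × ℝ), |J p| ≤ (1/2) * A p + 2 * Bf p := by
      intro p
      simp only [J, A, Bf]
      rw [hφ, abs_le]
      constructor
      · nlinarith [sq_nonneg (pdx h p * ψ p * ζ p + 2 * (h p * ψ p) * pdx ζ p),
          sq_nonneg (pdy h p * ψ p * ζ p + 2 * (h p * ψ p) * pdy ζ p)]
      · nlinarith [sq_nonneg (pdx h p * ψ p * ζ p - 2 * (h p * ψ p) * pdx ζ p),
          sq_nonneg (pdy h p * ψ p * ζ p - 2 * (h p * ψ p) * pdy ζ p)]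
    have iAB : Integrable (fun p => (1/2) * A p + 2 * Bf p) (volume.restrict Ω) :=
      (iA.const_mul _).add (iB.const_mul _)
    have iJ : Integrable J (volume.restrict Ω) := iAB.mono' mJ (Eventually.of_forall hpt)
    exact integral_mono iJ.neg iAB fun p => (neg_le_abs _).trans (hpt p)
  have hfin : (∫ p in Ω, A p) ≤ 4 * ∫ p in Ω, Bf p := by
    rw [integral_add (iA.const_mul _) (iB.const_mul _), integral_const_mul, integral_const_mul,
      ← hAJ] at hle
    linarith
  refine ⟨?_, hfin⟩
  have hA0 : 0 ≤ ∫ p in Ω, A p := integral_nonneg fun p => by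
    simp only [A, Pi.zero_apply]; positivity
  change (∫ p in Ω, A p) ≤ 2 * √(∫ p in Ω, A p) * √(∫ p in Ω, Bf p)
  have hs : √(∫ p in Ω, A p) ≤ 2 * √(∫ p in Ω, Bf p) := by
    have h4 : √(4:ℝ) = 2 := by
      rw [show (4:ℝ) = 2 ^ 2 by norm_num]; exact Real.sqrt_sq (by norm_num)
    rw [← h4, ← Real.sqrt_mul (by norm_num)]
    exact Real.sqrt_le_sqrt hfin
  have := mul_le_mul_of_nonneg_left hs (Real.sqrt_nonneg (∫ p in Ω, A p))
  rw [Real.mul_self_sqrt hA0] at this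
  linarith
end

section
/- Let u : ℝ² → ℝ be a bounded C² solution of Δu = F'(u) that is monotone in the y-direction (∂_y u > 0 everywhere) on ℝ². If additionally u is even in x (u(x,y) = u(−x,y)) and u(0,0) = 0 with u(x,y) → ±1 as y → ±∞, then u(x,y) = H(y), where H is the heteroclinic solution; in particular ∂_x u ≡ 0. -/
open Real Filter

noncomputable def lap (f : ℝ × ℝ → ℝ) (p : ℝ × ℝ) : ℝ := pdx (pdx f) p + pdy (pdy f) p

open MeasureTheory Topology

lemma dg_lineX (p : ℝ × ℝ) : HasDerivAt (fun t : ℝ => (t, p.2)) ((1 : ℝ), (0 : ℝ)) p.1 :=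
  (hasDerivAt_id p.1).prodMk (hasDerivAt_const p.1 p.2)

lemma dg_lineY (p : ℝ × ℝ) : HasDerivAt (fun t : ℝ => (p.1, t)) ((0 : ℝ), (1 : ℝ)) p.2 :=
  (hasDerivAt_const p.2 p.1).prodMk (hasDerivAt_id p.2)

lemma dg_hasX' {f : ℝ × ℝ → ℝ} {p : ℝ × ℝ} (hf : DifferentiableAt ℝ f p) :
    HasDerivAt (fun t => f (t, p.2)) (fderiv ℝ f p (1, 0)) p.1 :=
  HasFDerivAt.comp_hasDerivAt (x := p.1) (f := fun t : ℝ => (t, p.2)) (l := f)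
    (l' := fderiv ℝ f p) hf.hasFDerivAt (dg_lineX p)

lemma dg_hasY' {f : ℝ × ℝ → ℝ} {p : ℝ × ℝ} (hf : DifferentiableAt ℝ f p) :
    HasDerivAt (fun t => f (p.1, t)) (fderiv ℝ f p (0, 1)) p.2 :=
  HasFDerivAt.comp_hasDerivAt (x := p.2) (f := fun t : ℝ => (p.1, t)) (l := f)
    (l' := fderiv ℝ f p) hf.hasFDerivAt (dg_lineY p)

lemma dg_pdx_eq {f : ℝ × ℝ → ℝ} (hf : ContDiff ℝ 1 f) :
    pdx f = fun p => fderiv ℝ f p (1, 0) := by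
  funext p
  exact (dg_hasX' (hf.differentiable one_ne_zero p)).deriv

lemma dg_pdy_eq {f : ℝ × ℝ → ℝ} (hf : ContDiff ℝ 1 f) :
    pdy f = fun p => fderiv ℝ f p (0, 1) := by
  funext p
  exact (dg_hasY' (hf.differentiable one_ne_zero p)).deriv

lemma dg_hasX {f : ℝ × ℝ → ℝ} (hf : ContDiff ℝ 1 f) (p : ℝ × ℝ) :
    HasDerivAt (fun t => f (t, p.2)) (pdx f p) p.1 := by
  rw [dg_pdx_eq hf]; exact dg_hasX' (hf.differentiable one_ne_zero p)

lemma dg_hasY {f : ℝ × ℝ → ℝ} (hf : ContDiff ℝ 1 f) (p : ℝ × ℝ) :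
    HasDerivAt (fun t => f (p.1, t)) (pdy f p) p.2 := by
  rw [dg_pdy_eq hf]; exact dg_hasY' (hf.differentiable one_ne_zero p)

lemma dg_contX {f : ℝ × ℝ → ℝ} (hf : ContDiff ℝ 1 f) : Continuous (pdx f) := by
  rw [dg_pdx_eq hf]
  exact (hf.continuous_fderiv one_ne_zero).clm_apply continuous_const

lemma dg_contY {f : ℝ × ℝ → ℝ} (hf : ContDiff ℝ 1 f) : Continuous (pdy f) := by
  rw [dg_pdy_eq hf]
  exact (hf.continuous_fderiv one_ne_zero).clm_apply continuous_const

lemma dg_cdX {f : ℝ × ℝ → ℝ} (hf : ContDiff ℝ 2 f) : ContDiff ℝ 1 (pdx f) := by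
  rw [dg_pdx_eq (hf.of_le one_le_two)]
  exact (hf.fderiv_right (m := 1) (by norm_num)).clm_apply contDiff_const

lemma dg_cdY {f : ℝ × ℝ → ℝ} (hf : ContDiff ℝ 2 f) : ContDiff ℝ 1 (pdy f) := by
  rw [dg_pdy_eq (hf.of_le one_le_two)]
  exact (hf.fderiv_right (m := 1) (by norm_num)).clm_apply contDiff_const

lemma dg_symm {f : ℝ × ℝ → ℝ} (hf : ContDiff ℝ 2 f) (p : ℝ × ℝ) :
    pdx (pdy f) p = pdy (pdx f) p := by
  have h1 := hf.of_le one_le_two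
  have hd : DifferentiableAt ℝ (fderiv ℝ f) p :=
    (hf.fderiv_right (m := 1) (by norm_num)).differentiable one_ne_zero p
  rw [dg_pdx_eq (dg_cdY hf), dg_pdy_eq (dg_cdX hf), dg_pdx_eq h1, dg_pdy_eq h1]
  have hs : IsSymmSndFDerivAt ℝ f p := hf.contDiffAt.isSymmSndFDerivAt (by simp)
  have := hs (1, 0) (0, 1)
  simp only
  rw [fderiv_clm_apply hd (differentiableAt_const _), fderiv_clm_apply hd (differentiableAt_const _)]
  simpa using this

lemma dg_csX {f : ℝ × ℝ → ℝ} (hf : ContDiff ℝ 1 f) (hc : HasCompactSupport f) :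
    HasCompactSupport (pdx f) := by
  rw [dg_pdx_eq hf]
  exact hc.fderiv_apply ℝ (1, 0)

lemma dg_csY {f : ℝ × ℝ → ℝ} (hf : ContDiff ℝ 1 f) (hc : HasCompactSupport f) :
    HasCompactSupport (pdy f) := by
  rw [dg_pdy_eq hf]
  exact hc.fderiv_apply ℝ (0, 1)

lemma dg_int_fderiv {f : ℝ × ℝ → ℝ} (hf : ContDiff ℝ 1 f) (hc : HasCompactSupport f) (v : ℝ × ℝ) :
    ∫ p, fderiv ℝ f p v = 0 := by
  have hi : Integrable (fun p => fderiv ℝ f p v) :=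
    ((hf.continuous_fderiv one_ne_zero).clm_apply continuous_const).integrable_of_hasCompactSupport
      (hc.fderiv_apply ℝ v)
  have hi2 : Integrable f := hf.continuous.integrable_of_hasCompactSupport hc
  have := integral_mul_fderiv_eq_neg_fderiv_mul_of_integrable (μ := (volume : Measure (ℝ × ℝ)))
    (f := fun _ : ℝ × ℝ => (1 : ℝ)) (g := f) (v := v) (by simp) (by simpa using hi)
    (by simpa using hi2) (fun x _ => differentiableAt_const _)
    (fun x _ => hf.differentiable one_ne_zero x)
  simpa using this

lemma dg_intX {f : ℝ × ℝ → ℝ} (hf : ContDiff ℝ 1 f) (hc : HasCompactSupport f) :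
    ∫ p, pdx f p = 0 := by
  rw [dg_pdx_eq hf]; exact dg_int_fderiv hf hc _

lemma dg_intY {f : ℝ × ℝ → ℝ} (hf : ContDiff ℝ 1 f) (hc : HasCompactSupport f) :
    ∫ p, pdy f p = 0 := by
  rw [dg_pdy_eq hf]; exact dg_int_fderiv hf hc _

lemma dg_mulX {f g : ℝ × ℝ → ℝ} (hf : ContDiff ℝ 1 f) (hg : ContDiff ℝ 1 g) (p : ℝ × ℝ) :
    pdx (fun q => f q * g q) p = pdx f p * g p + f p * pdx g p :=
  ((dg_hasX hf p).mul (dg_hasX hg p)).deriv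

lemma dg_mulY {f g : ℝ × ℝ → ℝ} (hf : ContDiff ℝ 1 f) (hg : ContDiff ℝ 1 g) (p : ℝ × ℝ) :
    pdy (fun q => f q * g q) p = pdy f p * g p + f p * pdy g p :=
  ((dg_hasY hf p).mul (dg_hasY hg p)).deriv

/-- Differentiation of a correlation in the `y`-shift. -/
lemma dg_shift {f g : ℝ × ℝ → ℝ} (hf : Continuous f) (hfc : HasCompactSupport f)
    (hg : ContDiff ℝ 1 g) (hgc : HasCompactSupport g) :
    HasDerivAt (fun h : ℝ => ∫ p : ℝ × ℝ, f p * g (p.1, p.2 + h)) (∫ p, f p * pdy g p) 0 := by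
  obtain ⟨C, hC⟩ := (dg_contY hg).bounded_above_of_compact_support (dg_csY hg hgc)
  have key := hasDerivAt_integral_of_dominated_loc_of_deriv_le (μ := (volume : Measure (ℝ × ℝ)))
    (F := fun (h : ℝ) (p : ℝ × ℝ) => f p * g (p.1, p.2 + h))
    (F' := fun (h : ℝ) (p : ℝ × ℝ) => f p * pdy g (p.1, p.2 + h))
    (x₀ := (0 : ℝ)) (s := Set.univ) (bound := fun p => ‖f p‖ * C) Filter.univ_mem
    ?_ ?_ ?_ ?_ ?_ ?_
  · have := key.2
    simpa using this
  · refine Filter.Eventually.of_forall fun h => Continuous.aestronglyMeasurable ?_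
    have := hg.continuous
    fun_prop
  · refine Continuous.integrable_of_hasCompactSupport ?_ hfc.mul_right
    have := hg.continuous
    fun_prop
  · refine Continuous.aestronglyMeasurable ?_
    have := dg_contY hg
    fun_prop
  · refine Filter.Eventually.of_forall fun p h _ => ?_
    rw [norm_mul]
    exact mul_le_mul_of_nonneg_left (hC _) (norm_nonneg _)
  · exact ((hf.integrable_of_hasCompactSupport hfc).norm).mul_const C
  · refine Filter.Eventually.of_forall fun p h _ => ?_
    have h1 := dg_hasY hg (p.1, p.2 + h)
    have h2 : HasDerivAt (fun t => g (p.1, p.2 + t)) (pdy g (p.1, p.2 + h)) h :=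
      HasDerivAt.comp_const_add (f := fun t => g (p.1, t)) p.2 h h1
    exact h2.const_mul (f p)

/-- `∫ dP ∧ dζ = 0` for compactly supported `C¹` functions. -/
lemma dg_wedge {P z : ℝ × ℝ → ℝ} (hP : ContDiff ℝ 1 P) (hPc : HasCompactSupport P)
    (hz : ContDiff ℝ 1 z) (hzc : HasCompactSupport z) :
    ∫ p, pdx P p * pdy z p = ∫ p, pdx z p * pdy P p := by
  have h1 := dg_shift (dg_contX hP) (dg_csX hP hPc) hz hzc
  have h2 := dg_shift (dg_contX hz) (dg_csX hz hzc) hP hPc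
  have h3 : HasDerivAt (fun h : ℝ => -∫ p : ℝ × ℝ, pdx z p * P (p.1, p.2 + -h))
      (∫ p, pdx z p * pdy P p) 0 := by
    have h2' : HasDerivAt (fun h : ℝ => ∫ p : ℝ × ℝ, pdx z p * P (p.1, p.2 + h))
        (∫ p, pdx z p * pdy P p) (-0) := by simpa using h2
    have h4 := (HasDerivAt.comp (0 : ℝ) h2' (hasDerivAt_neg (0 : ℝ))).neg
    have e : -((∫ p, pdx z p * pdy P p) * (-1)) = ∫ p, pdx z p * pdy P p := by ring
    rw [e] at h4
    exact h4
  refine h1.unique ?_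
  refine h3.congr_of_eventuallyEq (Filter.Eventually.of_forall fun h => ?_)
  simp only
  have hsm : ContDiff ℝ 1 (fun p : ℝ × ℝ => (p.1, p.2 + h)) := by fun_prop
  have hz' : ContDiff ℝ 1 (fun p : ℝ × ℝ => z (p.1, p.2 + h)) := hz.comp hsm
  have hzx : ∀ p : ℝ × ℝ, pdx (fun p : ℝ × ℝ => z (p.1, p.2 + h)) p = pdx z (p.1, p.2 + h) :=
    fun p => rfl
  have hint := dg_intX (hP.mul hz') hPc.mul_right
  have e : (fun p => pdx (fun q => P q * z (q.1, q.2 + h)) p) =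
      fun p => pdx P p * z (p.1, p.2 + h) + P p * pdx z (p.1, p.2 + h) := by
    funext p
    rw [dg_mulX hP hz' p, hzx]
  have hint' : ∫ p, pdx (fun q => P q * z (q.1, q.2 + h)) p = 0 := hint
  rw [e, integral_add] at hint'
  rotate_left
  · refine Continuous.integrable_of_hasCompactSupport ?_ (dg_csX hP hPc).mul_right
    have := hz'.continuous
    have := dg_contX hP
    fun_prop
  · refine Continuous.integrable_of_hasCompactSupport ?_ hPc.mul_right
    have := dg_contX hz
    have := hP.continuous
    fun_prop
  have htr := integral_add_right_eq_self (μ := (volume : Measure (ℝ × ℝ)))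
    (fun p : ℝ × ℝ => pdx z p * P (p.1, p.2 + -h)) ((0 : ℝ), h)
  have e2 : (fun p : ℝ × ℝ => P p * pdx z (p.1, p.2 + h)) =
      fun p : ℝ × ℝ => pdx z (p + (0, h)) * P ((p + (0, h)).1, (p + (0, h)).2 + -h) := by
    funext p
    obtain ⟨a, b⟩ := p
    simp [mul_comm]
  rw [e2, htr] at hint'
  linarith

/-- Cutoff functions. -/
lemma dg_cutoff : ∃ (η : ℕ → ℝ × ℝ → ℝ) (C : ℝ), 0 ≤ C ∧ (∀ k, ContDiff ℝ 1 (η k)) ∧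
    (∀ k, HasCompactSupport (η k)) ∧ (∀ k p, 0 ≤ η k p) ∧ (∀ k p, η k p ≤ 1) ∧
    (∀ k p, η k p ≠ 0 → η (k + 1) p = 1) ∧
    (∀ k p, |pdx (η k) p| ≤ C / 2 ^ k) ∧ (∀ k p, |pdy (η k) p| ≤ C / 2 ^ k) ∧
    (∀ k p, η k p ≠ 0 → p ∈ Set.Icc (-(2 * 2 ^ k) : ℝ) (2 * 2 ^ k) ×ˢ
      Set.Icc (-(2 * 2 ^ k) : ℝ) (2 * 2 ^ k)) ∧
    (∀ p, ∃ k, η k p = 1) := by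
  let χ : ContDiffBump (0 : ℝ) := ⟨1, 2, one_pos, one_lt_two⟩
  have hχ : ContDiff ℝ 1 χ := χ.contDiff
  obtain ⟨C, hC⟩ := (hχ.continuous_deriv le_rfl).bounded_above_of_compact_support
    χ.hasCompactSupport.deriv
  have one : ∀ x : ℝ, |x| ≤ 1 → χ x = 1 := fun x hx =>
    χ.one_of_mem_closedBall (by simpa [χ] using hx)
  have zero : ∀ x : ℝ, χ x ≠ 0 → |x| ≤ 2 := by
    intro x hx
    by_contra hlt
    exact hx (χ.zero_of_le_dist (by simpa [χ] using (not_le.1 hlt).le))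
  have hs : ∀ k : ℕ, ContDiff ℝ 1 (fun p : ℝ × ℝ => χ (p.1 / 2 ^ k) * χ (p.2 / 2 ^ k)) := by
    intro k
    have h1 : ContDiff ℝ 1 (fun p : ℝ × ℝ => χ (p.1 / 2 ^ k)) :=
      hχ.comp (contDiff_fst.div_const _)
    have h2 : ContDiff ℝ 1 (fun p : ℝ × ℝ => χ (p.2 / 2 ^ k)) :=
      hχ.comp (contDiff_snd.div_const _)
    exact h1.mul h2
  have pk : ∀ k : ℕ, (0 : ℝ) < 2 ^ k := fun k => by positivity
  have habs : ∀ (k : ℕ) (x : ℝ), |x / 2 ^ k| = |x| / 2 ^ k := by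
    intro k x; rw [abs_div, abs_of_pos (pk k)]
  have supp : ∀ (k : ℕ) (p : ℝ × ℝ), χ (p.1 / 2 ^ k) * χ (p.2 / 2 ^ k) ≠ 0 →
      |p.1| ≤ 2 * 2 ^ k ∧ |p.2| ≤ 2 * 2 ^ k := by
    intro k p hp
    have h1 := zero _ (left_ne_zero_of_mul hp)
    have h2 := zero _ (right_ne_zero_of_mul hp)
    rw [habs, div_le_iff₀ (pk k)] at h1 h2
    exact ⟨h1, h2⟩
  have hderiv : ∀ (k : ℕ) (x : ℝ), HasDerivAt (fun t : ℝ => χ (t / 2 ^ k))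
      (deriv χ (x / 2 ^ k) * (1 / 2 ^ k)) x := by
    intro k x
    have := ((hχ.differentiable one_ne_zero) (x / 2 ^ k)).hasDerivAt
    exact HasDerivAt.comp (h₂ := fun t => χ t) (h := fun t : ℝ => t / 2 ^ k) x this ((hasDerivAt_id x).div_const _)
  have hb : ∀ (k : ℕ) (x y : ℝ), |deriv χ (x / 2 ^ k) * (1 / 2 ^ k) * χ y| ≤ C / 2 ^ k := by
    intro k x y
    have h1 := hC (x / 2 ^ k)
    rw [Real.norm_eq_abs] at h1
    have h2 : |χ y| ≤ 1 := by rw [abs_of_nonneg χ.nonneg]; exact χ.le_one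
    rw [abs_mul, abs_mul, abs_of_pos (by have := pk k; positivity : (0 : ℝ) < 1 / 2 ^ k)]
    calc _ ≤ C * (1 / 2 ^ k) * 1 := by
          have := pk k
          have h0 : 0 ≤ C := (abs_nonneg _).trans h1
          gcongr
      _ = _ := by ring
  have C0 : 0 ≤ C := (norm_nonneg _).trans (hC 0)
  refine ⟨fun k p => χ (p.1 / 2 ^ k) * χ (p.2 / 2 ^ k), C, C0, hs, ?_, ?_, ?_, ?_, ?_, ?_, ?_, ?_⟩
  · intro k
    refine HasCompactSupport.intro ((isCompact_Icc (a := (-(2 * 2 ^ k) : ℝ)) (b := 2 * 2 ^ k)).prod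
      (isCompact_Icc (a := (-(2 * 2 ^ k) : ℝ)) (b := 2 * 2 ^ k))) ?_
    intro p hp
    by_contra hne
    have := supp k p hne
    exact hp ⟨abs_le.1 this.1, abs_le.1 this.2⟩
  · intro k p; exact mul_nonneg χ.nonneg χ.nonneg
  · intro k p; exact mul_le_one₀ χ.le_one χ.nonneg χ.le_one
  · intro k p hp
    have := supp k p hp
    have e : (2 : ℝ) ^ (k + 1) = 2 * 2 ^ k := by ring
    simp only
    rw [one, one, one_mul]
    · rw [habs, div_le_one (pk _), e]; exact this.2
    · rw [habs, div_le_one (pk _), e]; exact this.1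
  · intro k p
    have : pdx (fun p : ℝ × ℝ => χ (p.1 / 2 ^ k) * χ (p.2 / 2 ^ k)) p =
      deriv χ (p.1 / 2 ^ k) * (1 / 2 ^ k) * χ (p.2 / 2 ^ k) :=
      ((hderiv k p.1).mul_const (χ (p.2 / 2 ^ k))).deriv
    rw [this]; exact hb _ _ _
  · intro k p
    have : pdy (fun p : ℝ × ℝ => χ (p.1 / 2 ^ k) * χ (p.2 / 2 ^ k)) p =
      χ (p.1 / 2 ^ k) * (deriv χ (p.2 / 2 ^ k) * (1 / 2 ^ k)) :=
      ((hderiv k p.2).const_mul (χ (p.1 / 2 ^ k))).deriv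
    rw [this, mul_comm]; exact hb _ _ _
  · intro k p hp
    have := supp k p hp
    exact ⟨abs_le.1 this.1, abs_le.1 this.2⟩
  · intro p
    obtain ⟨k, hk⟩ := pow_unbounded_of_one_lt (max |p.1| |p.2|) (one_lt_two (α := ℝ))
    refine ⟨k, ?_⟩
    simp only
    rw [one, one, one_mul]
    · rw [habs, div_le_one (pk _)]; exact ((le_max_right _ _).trans hk.le)
    · rw [habs, div_le_one (pk _)]; exact ((le_max_left _ _).trans hk.le)

lemma dg_seq {a : ℕ → ℝ} {B : ℝ} (hB : 0 ≤ B) (h0 : ∀ k, 0 ≤ a k) (hm : Monotone a)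
    (h : ∀ k (ε : ℝ), 0 < ε → a (k + 1) ≤ ε * (a (k + 1) - a k) + B / ε) (k : ℕ) : a k = 0 := by
  have hb : ∀ k, a k ≤ 4 * B := by
    intro k
    have h1 := h k (1 / 2) (by norm_num)
    have h2 : B / (1 / 2) = 2 * B := by ring
    have h3 := hm (Nat.le_succ k)
    have h4 := h0 k
    simp only [Nat.succ_eq_add_one] at h3
    rw [h2] at h1
    linarith
  have hlim := tendsto_atTop_ciSup hm ⟨4 * B, by rintro _ ⟨k, rfl⟩; exact hb k⟩
  set L := ⨆ k, a k
  have hlim' := (Filter.tendsto_add_atTop_iff_nat 1).2 hlim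
  have hL : ∀ ε : ℝ, 0 < ε → L ≤ B / ε := by
    intro ε hε
    have h5 : Tendsto (fun k => ε * (a (k + 1) - a k) + B / ε) atTop
        (𝓝 (ε * (L - L) + B / ε)) := ((hlim'.sub hlim).const_mul ε).add_const _
    have := le_of_tendsto_of_tendsto' hlim' h5 (fun k => h k ε hε)
    simpa using this
  have hL0 : L ≤ 0 := by
    have h6 : Tendsto (fun ε : ℝ => B / ε) atTop (𝓝 0) := tendsto_const_nhds.div_atTop tendsto_id
    exact ge_of_tendsto h6 ((eventually_gt_atTop 0).mono fun ε hε => hL ε hε)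
  have hk : a k ≤ L := hm.ge_of_tendsto hlim k
  exact le_antisymm (hk.trans hL0) (h0 k)

lemma dg_min {η : ℝ × ℝ → ℝ} (h0 : ∀ p, 0 ≤ η p) {p : ℝ × ℝ} (hp : η p = 0) :
    pdx η p = 0 ∧ pdy η p = 0 := by
  constructor
  · refine IsLocalMin.deriv_eq_zero (Filter.Eventually.of_forall fun t => ?_)
    change η p ≤ _; rw [hp]; exact h0 _
  · refine IsLocalMin.deriv_eq_zero (Filter.Eventually.of_forall fun t => ?_)
    change η p ≤ _; rw [hp]; exact h0 _

lemma dg_max {η : ℝ × ℝ → ℝ} (h0 : ∀ p, η p ≤ 1) {p : ℝ × ℝ} (hp : η p = 1) :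
    pdx η p = 0 ∧ pdy η p = 0 := by
  constructor
  · refine IsLocalMax.deriv_eq_zero (Filter.Eventually.of_forall fun t => ?_)
    change _ ≤ η p; rw [hp]; exact h0 _
  · refine IsLocalMax.deriv_eq_zero (Filter.Eventually.of_forall fun t => ?_)
    change _ ≤ η p; rw [hp]; exact h0 _

/-- Caccioppoli-type energy estimate on one cutoff. -/
lemma dg_energy {F : ℝ → ℝ} {u : ℝ × ℝ → ℝ} (hF : Continuous (deriv F)) (hu : ContDiff ℝ 2 u)
    (hubdd : ∀ p : ℝ × ℝ, |u p| ≤ 1)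
    (hsol : ∀ p : ℝ × ℝ, lap u p = deriv F (u p)) {M : ℝ} (hM : ∀ p, |deriv F (u p)| ≤ M)
    {η : ℝ × ℝ → ℝ} {C R : ℝ} (hR : 0 ≤ R) (hη : ContDiff ℝ 1 η) (hc : HasCompactSupport η)
    (h0 : ∀ p, 0 ≤ η p) (h1 : ∀ p, η p ≤ 1) (hx : ∀ p, |pdx η p| ≤ C) (hy : ∀ p, |pdy η p| ≤ C)
    (hs : ∀ p, η p ≠ 0 → p ∈ Set.Icc (-R) R ×ˢ Set.Icc (-R) R) :
    ∫ p, η p ^ 2 * (pdx u p ^ 2 + pdy u p ^ 2) ≤ 8 * (M + 4 * C ^ 2) * R ^ 2 := by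
  have hu1 := hu.of_le one_le_two
  have cx := dg_contX hu1
  have cy := dg_contY hu1
  have cη := hη.continuous
  have cηx := dg_contX hη
  have cηy := dg_contY hη
  have cu := hu.continuous
  set T : ℝ × ℝ → ℝ := fun p => η p ^ 2 * (pdx u p ^ 2 + pdy u p ^ 2)
    + η p ^ 2 * u p * deriv F (u p)
    + 2 * η p * u p * (pdx η p * pdx u p + pdy η p * pdy u p) with hT
  have s1 : ContDiff ℝ 1 (fun p => η p * η p) := hη.mul hη
  have s2 : ContDiff ℝ 1 (fun p => u p * pdx u p) := hu1.mul (dg_cdX hu)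
  have s3 : ContDiff ℝ 1 (fun p => u p * pdy u p) := hu1.mul (dg_cdY hu)
  have hTint : ∫ p, T p = 0 := by
    have i1 := dg_intX (s1.mul s2) (HasCompactSupport.mul_right (hc.mul_right))
    have i2 := dg_intY (s1.mul s3) (HasCompactSupport.mul_right (hc.mul_right))
    have j1 : Integrable (pdx (fun p => (η p * η p) * (u p * pdx u p))) :=
      (dg_contX (s1.mul s2)).integrable_of_hasCompactSupport
        (dg_csX (s1.mul s2) (HasCompactSupport.mul_right (hc.mul_right)))
    have j2 : Integrable (pdy (fun p => (η p * η p) * (u p * pdy u p))) :=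
      (dg_contY (s1.mul s3)).integrable_of_hasCompactSupport
        (dg_csY (s1.mul s3) (HasCompactSupport.mul_right (hc.mul_right)))
    have : T = fun p => pdx (fun p => (η p * η p) * (u p * pdx u p)) p
        + pdy (fun p => (η p * η p) * (u p * pdy u p)) p := by
      funext p
      have e := hsol p
      unfold lap at e
      rw [dg_mulX s1 s2, dg_mulY s1 s3, dg_mulX hη hη, dg_mulY hη hη, dg_mulX hu1 (dg_cdX hu),
        dg_mulY hu1 (dg_cdY hu)]
      simp only [hT]
      rw [← e]
      ring
    rw [this, integral_add j1 j2]
    have i1' : ∫ p, pdx (fun p => (η p * η p) * (u p * pdx u p)) p = 0 := i1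
    have i2' : ∫ p, pdy (fun p => (η p * η p) * (u p * pdy u p)) p = 0 := i2
    rw [i1', i2', add_zero]
  have cG : Continuous (fun p => η p ^ 2 * (pdx u p ^ 2 + pdy u p ^ 2)) := by fun_prop
  have cT : Continuous T := by
    have : Continuous (fun p => deriv F (u p)) := hF.comp cu
    simp only [hT]
    fun_prop
  have hvan : ∀ p, η p = 0 → T p = 0 := by
    intro p hp; simp [hT, hp]
  have iT : Integrable T := cT.integrable_of_hasCompactSupport
    (hc.mono fun p hp hp' => hp (hvan p hp'))
  have iG : Integrable (fun p => η p ^ 2 * (pdx u p ^ 2 + pdy u p ^ 2)) :=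
    cG.integrable_of_hasCompactSupport (hc.mono fun p hp hp' => hp (by simp [hp']))
  set Q := Set.Icc (-R) R ×ˢ Set.Icc (-R) R with hQ
  have mQ : MeasurableSet Q := measurableSet_Icc.prod measurableSet_Icc
  have vQ : volume.real Q = (2 * R) ^ 2 := by
    rw [hQ, Measure.real, Measure.volume_eq_prod, Measure.prod_prod, Real.volume_Icc,
      ENNReal.toReal_mul, ENNReal.toReal_ofReal (by linarith)]
    ring
  have fQ : volume Q ≠ ⊤ := (isCompact_Icc.prod isCompact_Icc).measure_lt_top.ne
  have M0 : 0 ≤ M := (abs_nonneg _).trans (hM 0)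
  have hpt : ∀ p, (1 / 2) * (η p ^ 2 * (pdx u p ^ 2 + pdy u p ^ 2)) - T p ≤
      Q.indicator (fun _ => M + 4 * C ^ 2) p := by
    intro p
    by_cases hp : η p = 0
    · rw [hvan p hp, hp]
      simp only [ne_eq, OfNat.ofNat_ne_zero, not_false_eq_true, zero_pow, zero_mul, mul_zero,
        sub_zero]
      exact Set.indicator_nonneg (fun _ _ => by positivity) p
    · rw [Set.indicator_of_mem (hs p hp)]
      have b1 : -(η p ^ 2 * u p * deriv F (u p)) ≤ M := by
        have : |η p ^ 2 * u p * deriv F (u p)| ≤ 1 * 1 * M := by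
          rw [abs_mul, abs_mul]
          have : |η p ^ 2| ≤ 1 := by
            rw [abs_of_nonneg (sq_nonneg _)]; exact pow_le_one₀ (h0 p) (h1 p)
          have := hubdd p
          have := hM p
          gcongr
        have := neg_abs_le (η p ^ 2 * u p * deriv F (u p))
        linarith
      have b2 : (pdx η p) ^ 2 ≤ C ^ 2 := sq_le_sq' (abs_le.1 (hx p)).1 (abs_le.1 (hx p)).2
      have b3 : (pdy η p) ^ 2 ≤ C ^ 2 := sq_le_sq' (abs_le.1 (hy p)).1 (abs_le.1 (hy p)).2
      have b4 : (u p) ^ 2 ≤ 1 := (sq_le_one_iff_abs_le_one _).2 (hubdd p)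
      have b5 : (u p) ^ 2 * (pdx η p) ^ 2 ≤ C ^ 2 :=
        (mul_le_of_le_one_left (sq_nonneg _) b4).trans b2
      have b6 : (u p) ^ 2 * (pdy η p) ^ 2 ≤ C ^ 2 :=
        (mul_le_of_le_one_left (sq_nonneg _) b4).trans b3
      simp only [hT]
      nlinarith [sq_nonneg (η p * pdx u p + 2 * u p * pdx η p),
        sq_nonneg (η p * pdy u p + 2 * u p * pdy η p)]
  have hfin := integral_mono ((iG.const_mul (1 / 2)).sub iT)
    ((integrable_indicator_iff mQ).2 (integrableOn_const fQ)) hpt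
  have e1 : ∫ p, ((fun p : ℝ × ℝ => (1 / 2) * (η p ^ 2 * (pdx u p ^ 2 + pdy u p ^ 2))) - T : ℝ × ℝ → ℝ) p =
      (1 / 2) * (∫ p, η p ^ 2 * (pdx u p ^ 2 + pdy u p ^ 2)) - 0 := by
    rw [← hTint, ← integral_const_mul]
    exact integral_sub (iG.const_mul (1 / 2)) iT
  rw [e1, integral_indicator mQ, setIntegral_const, vQ, smul_eq_mul] at hfin
  linarith

/-- The ratio `u_x / u_y` has vanishing gradient. -/
lemma dg_flat {F : ℝ → ℝ} (hF : ContDiff ℝ (⊤ : ℕ∞) F)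
    {u : ℝ × ℝ → ℝ} (hu : ContDiff ℝ 2 u)
    (hubdd : ∀ p : ℝ × ℝ, |u p| ≤ 1)
    (hsol : ∀ p : ℝ × ℝ, lap u p = deriv F (u p))
    (hmono : ∀ p : ℝ × ℝ, 0 < pdy u p) (p : ℝ × ℝ) :
    pdx (fun q => pdx u q / pdy u q) p = 0 := by
  have hF1 : ContDiff ℝ 1 F := hF.of_le (by exact_mod_cast le_top)
  have cF' : Continuous (deriv F) := hF1.continuous_deriv le_rfl
  obtain ⟨M, hM⟩ : ∃ M, ∀ p, |deriv F (u p)| ≤ M := by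
    obtain ⟨M, hM⟩ := (isCompact_Icc (a := (-1 : ℝ)) (b := 1)).exists_bound_of_continuousOn
      cF'.continuousOn
    exact ⟨M, fun p => hM _ (abs_le.1 (hubdd p))⟩
  have M0 : 0 ≤ M := (abs_nonneg _).trans (hM 0)
  obtain ⟨η, C, C0, hη, hc, h0, h1, hstep, hx, hy, hs, hone⟩ := dg_cutoff
  have hu1 := hu.of_le one_le_two
  have dX := dg_cdX hu
  have dY := dg_cdY hu
  have cX := dX.continuous
  have cY := dY.continuous
  set σ : ℝ × ℝ → ℝ := fun q => pdx u q / pdy u q with hσ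
  have dσ : ContDiff ℝ 1 σ := dX.div dY (fun q => (hmono q).ne')
  have cσx := dg_contX dσ
  have cσy := dg_contY dσ
  have hUσ : (fun q => σ q * pdy u q) = pdx u := by
    funext q; simp only [hσ]; field_simp [(hmono q).ne']
  have hUσ' : ∀ q, σ q * pdy u q = pdx u q := fun q => congrFun hUσ q
  have xx : ∀ q, pdx (pdx u) q = pdx σ q * pdy u q + σ q * pdx (pdy u) q := by
    intro q; conv_lhs => rw [← hUσ]
    exact dg_mulX dσ dY q
  have xy : ∀ q, pdy (pdx u) q = pdy σ q * pdy u q + σ q * pdy (pdy u) q := by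
    intro q; conv_lhs => rw [← hUσ]
    exact dg_mulY dσ dY q
  -- the stream function
  set P : ℝ × ℝ → ℝ := fun q => (pdx u q ^ 2 + pdy u q ^ 2) / 2 - F (u q) with hP
  have dP : ContDiff ℝ 1 P := (((dX.pow 2).add (dY.pow 2)).div_const 2).sub (hF1.comp hu1)
  have Px : ∀ q, pdx P q = pdy u q ^ 2 * pdy σ q := by
    intro q
    have hFd : HasDerivAt F (deriv F (u q)) (u q) :=
      (hF1.differentiable one_ne_zero (u q)).hasDerivAt
    have hFu : HasDerivAt (fun t => F (u (t, q.2))) (deriv F (u q) * pdx u q) q.1 :=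
      HasDerivAt.comp (h₂ := F) (h := fun t => u (t, q.2)) q.1 hFd (dg_hasX hu1 q)
    have hd : pdx P q = _ :=
      (((((dg_hasX dX q).pow 2).add ((dg_hasX dY q).pow 2)).div_const 2).sub hFu).deriv
    rw [hd]
    have e := hsol q
    unfold lap at e
    have e2 := dg_symm hu q
    have e3 := hUσ' q
    have e4 := xy q
    have e5 := xx q
    simp only [Prod.mk.eta]
    push_cast
    rw [← e, e2, e4, ← e3]
    ring
  have Py : ∀ q, pdy P q = -(pdy u q ^ 2 * pdx σ q) := by
    intro q
    have hFd : HasDerivAt F (deriv F (u q)) (u q) :=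
      (hF1.differentiable one_ne_zero (u q)).hasDerivAt
    have hFu : HasDerivAt (fun t => F (u (q.1, t))) (deriv F (u q) * pdy u q) q.2 :=
      HasDerivAt.comp (h₂ := F) (h := fun t => u (q.1, t)) q.2 hFd (dg_hasY hu1 q)
    have hd : pdy P q = _ :=
      (((((dg_hasY dX q).pow 2).add ((dg_hasY dY q).pow 2)).div_const 2).sub hFu).deriv
    rw [hd]
    have e := hsol q
    unfold lap at e
    have e2 := dg_symm hu q
    have e3 := hUσ' q
    have e5 := xx q
    simp only [Prod.mk.eta]
    push_cast
    rw [← e, ← e2, e5, ← e3]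
    ring
  set E : ℝ × ℝ → ℝ := fun q => pdy u q ^ 2 * (pdx σ q ^ 2 + pdy σ q ^ 2) with hE
  have cE : Continuous E := by simp only [hE]; fun_prop
  have E0 : ∀ q, 0 ≤ E q := fun q => by simp only [hE]; positivity
  have iη : ∀ (k : ℕ) (G : ℝ × ℝ → ℝ), Continuous G → Integrable (fun q => η k q ^ 2 * G q) := by
    intro k G hG
    have := (hη k).continuous
    refine Continuous.integrable_of_hasCompactSupport (by fun_prop) ?_
    exact (hc k).mono fun q hq hq' => hq (by simp [hq'])
  set A : ℕ → ℝ × ℝ → ℝ := fun k q => η k q ^ 2 * E q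
    + 2 * η k q * pdx u q * pdy u q * (pdx (η k) q * pdx σ q + pdy (η k) q * pdy σ q) with hA
  have iA : ∀ k, Integrable (A k) := by
    intro k
    have := (hη k).continuous
    have := dg_contX (hη k)
    have := dg_contY (hη k)
    refine Continuous.integrable_of_hasCompactSupport (by simp only [hA]; fun_prop) ?_
    exact (hc k).mono fun q hq hq' => hq (by simp only [hA]; simp [hq'])
  have intA : ∀ k, ∫ q, A k q = 0 := by
    intro k
    have s1 : ContDiff ℝ 1 (fun q => η k q * η k q) := (hη k).mul (hη k)
    have dz : ContDiff ℝ 1 (fun q => (η k q * η k q) * σ q) := s1.mul dσ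
    have dPt : ContDiff ℝ 1 (fun q => η (k + 1) q * P q) := (hη (k + 1)).mul dP
    have cz : HasCompactSupport (fun q => (η k q * η k q) * σ q) :=
      HasCompactSupport.mul_right (HasCompactSupport.mul_right (hc k))
    have cPt : HasCompactSupport (fun q => η (k + 1) q * P q) :=
      HasCompactSupport.mul_right (hc (k + 1))
    have hw := dg_wedge dPt cPt dz cz
    have ix : Integrable (fun q => pdx (fun q => η (k + 1) q * P q) q *
        pdy (fun q => (η k q * η k q) * σ q) q) :=
      ((dg_contX dPt).mul (dg_contY dz)).integrable_of_hasCompactSupport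
        (dg_csX dPt cPt).mul_right
    have iy : Integrable (fun q => pdx (fun q => (η k q * η k q) * σ q) q *
        pdy (fun q => η (k + 1) q * P q) q) :=
      ((dg_contX dz).mul (dg_contY dPt)).integrable_of_hasCompactSupport
        (dg_csX dz cz).mul_right
    have : A k = fun q => pdx (fun q => η (k + 1) q * P q) q *
        pdy (fun q => (η k q * η k q) * σ q) q - pdx (fun q => (η k q * η k q) * σ q) q *
        pdy (fun q => η (k + 1) q * P q) q := by
      funext q
      rw [dg_mulX (hη (k + 1)) dP, dg_mulY (hη (k + 1)) dP, dg_mulX s1 dσ, dg_mulY s1 dσ,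
        dg_mulX (hη k) (hη k), dg_mulY (hη k) (hη k), Px, Py]
      simp only [hA, hE]
      by_cases hq : η k q = 0
      · rw [hq]; ring
      · have h2 := hstep k q hq
        have h3 := dg_max (h1 (k + 1)) h2
        rw [h2, h3.1, h3.2, ← hUσ' q]
        ring
    rw [this, integral_sub ix iy, hw, sub_self]
  -- energy
  set B : ℝ := 32 * (M + 4 * C ^ 2) with hB
  have hen : ∀ k, ∫ q, η k q ^ 2 * (pdx u q ^ 2 + pdy u q ^ 2) ≤ B * 4 ^ k := by
    intro k
    have hp2 : (1 : ℝ) ≤ 2 ^ k := one_le_pow₀ one_le_two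
    have hCk : C / 2 ^ k ≤ C := div_le_self C0 hp2
    have := dg_energy cF' hu hubdd hsol hM (η := η k) (C := C) (R := 2 * 2 ^ k) (by positivity)
      (hη k) (hc k) (h0 k) (h1 k) (fun q => (hx k q).trans hCk) (fun q => (hy k q).trans hCk) (hs k)
    refine this.trans_eq ?_
    rw [hB, mul_pow, ← pow_mul, mul_comm k 2, pow_mul]
    ring
  have hle : ∀ k q, η k q ^ 2 ≤ η (k + 1) q ^ 2 := by
    intro k q
    by_cases hq : η k q = 0
    · rw [hq, zero_pow two_ne_zero]; exact sq_nonneg _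
    · rw [hstep k q hq]; exact pow_le_pow_left₀ (h0 k q) (h1 k q) 2
  have key := dg_seq (a := fun k => ∫ q, η k q ^ 2 * E q) (B := 8 * C ^ 2 * B)
    (by rw [hB]; positivity)
    (fun k => integral_nonneg fun q => mul_nonneg (sq_nonneg _) (E0 q))
    (monotone_nat_of_le_succ fun k => integral_mono (iη k E cE) (iη (k + 1) E cE)
      fun q => mul_le_mul_of_nonneg_right (hle k q) (E0 q)) ?_
  · obtain ⟨k, hk⟩ := hone p
    have hz := key k
    have hint0 := (integral_eq_zero_iff_of_nonneg
      (fun q => mul_nonneg (sq_nonneg (η k q)) (E0 q)) (iη k E cE)).1 hz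
    have cc : Continuous (fun q => η k q ^ 2 * E q) := by
      have := (hη k).continuous
      fun_prop
    have heq := (Continuous.ae_eq_iff_eq volume cc continuous_const).1 hint0
    have hp := congrFun heq p
    simp only [hk, hE, one_pow, one_mul] at hp
    have hpp := pow_pos (hmono p) 2
    have : pdx σ p ^ 2 + pdy σ p ^ 2 = 0 := (mul_eq_zero.1 hp).resolve_left hpp.ne'
    nlinarith [sq_nonneg (pdx σ p), sq_nonneg (pdy σ p)]
  · intro k ε hε
    have hpt : ∀ q, η (k + 1) q ^ 2 * E q - A (k + 1) q ≤
        ε * (η (k + 1) q ^ 2 * E q - η k q ^ 2 * E q) +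
        (2 * C ^ 2 / 4 ^ (k + 1) / ε) * (η (k + 2) q ^ 2 * (pdx u q ^ 2 + pdy u q ^ 2)) := by
      intro q
      have n2 : 0 ≤ (2 * C ^ 2 / 4 ^ (k + 1) / ε) *
          (η (k + 2) q ^ 2 * (pdx u q ^ 2 + pdy u q ^ 2)) := by positivity
      have n1 : 0 ≤ ε * (η (k + 1) q ^ 2 * E q - η k q ^ 2 * E q) :=
        mul_nonneg hε.le (sub_nonneg.2 (mul_le_mul_of_nonneg_right (hle k q) (E0 q)))
      by_cases hq0 : η (k + 1) q = 0
      · have : A (k + 1) q = 0 := by simp [hA, hq0]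
        rw [this]
        have : η (k + 1) q ^ 2 * E q - 0 = 0 := by simp [hq0]
        linarith
      by_cases hq1 : η (k + 1) q = 1
      · have h3 := dg_max (h1 (k + 1)) hq1
        have : η (k + 1) q ^ 2 * E q - A (k + 1) q = 0 := by
          simp only [hA]; rw [h3.1, h3.2]; ring
        linarith
      have hk0 : η k q = 0 := by
        by_contra hne; exact hq1 (hstep k q hne)
      have hk2 : η (k + 2) q = 1 := hstep (k + 1) q hq0
      rw [hk0, hk2]
      have sqb : ∀ a : ℝ, |a| ≤ C / 2 ^ (k + 1) → a ^ 2 ≤ C ^ 2 / 4 ^ (k + 1) := by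
        intro a ha
        have := sq_le_sq' (abs_le.1 ha).1 (abs_le.1 ha).2
        refine this.trans_eq ?_
        rw [div_pow, ← pow_mul, mul_comm (k + 1) 2, pow_mul]
        norm_num
      have bx := sqb _ (hx (k + 1) q)
      have bdy := sqb _ (hy (k + 1) q)
      set D := C ^ 2 / 4 ^ (k + 1) with hD
      have eD : 2 * C ^ 2 / 4 ^ (k + 1) / ε = 2 * D / ε := by rw [hD]; ring
      rw [eD]
      simp only [hA, hE]
      set n := η (k + 1) q
      set a := pdx (η (k + 1)) q
      set b := pdy (η (k + 1)) q
      set U := pdx u q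
      set V := pdy u q
      set s := pdx σ q
      set t := pdy σ q
      have g1 : -(2 * n * U * V * (a * s + b * t)) ≤
          ε * (n ^ 2 * (V ^ 2 * (s ^ 2 + t ^ 2))) + (U ^ 2 * (a ^ 2 + b ^ 2)) / ε := by
        have : ε * (n ^ 2 * (V ^ 2 * (s ^ 2 + t ^ 2))) + (U ^ 2 * (a ^ 2 + b ^ 2)) / ε
            + 2 * n * U * V * (a * s + b * t) =
            ((ε * n * V * s + U * a) ^ 2 + (ε * n * V * t + U * b) ^ 2) / ε := by
          field_simp
          ring
        have : 0 ≤ ((ε * n * V * s + U * a) ^ 2 + (ε * n * V * t + U * b) ^ 2) / ε := by positivity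
        linarith
      have g2 : (U ^ 2 * (a ^ 2 + b ^ 2)) / ε ≤ 2 * D / ε * (1 ^ 2 * (U ^ 2 + V ^ 2)) := by
        have D0 : 0 ≤ D := by positivity
        have : 2 * D / ε * (1 ^ 2 * (U ^ 2 + V ^ 2)) = (2 * D * (U ^ 2 + V ^ 2)) / ε := by ring
        rw [this]
        refine div_le_div_of_nonneg_right ?_ hε.le
        nlinarith [mul_le_mul_of_nonneg_left bx (sq_nonneg U),
          mul_le_mul_of_nonneg_left bdy (sq_nonneg U), mul_nonneg D0 (sq_nonneg V)]
      linarith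
    have cu2 : Continuous (fun q => pdx u q ^ 2 + pdy u q ^ 2) := by fun_prop
    have I1 := iη (k + 1) E cE
    have I0 := iη k E cE
    have I2 := iη (k + 2) _ cu2
    have hi := integral_mono (I1.sub (iA (k + 1)))
      (((I1.sub I0).const_mul ε).add (I2.const_mul (2 * C ^ 2 / 4 ^ (k + 1) / ε))) hpt
    have l1 : ∫ q, ((fun q => η (k + 1) q ^ 2 * E q) - A (k + 1)) q =
        (∫ q, η (k + 1) q ^ 2 * E q) - 0 := by
      rw [← intA (k + 1)]; exact integral_sub I1 (iA (k + 1))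
    have l2 := integral_add ((I1.sub I0).const_mul ε)
      (I2.const_mul (2 * C ^ 2 / 4 ^ (k + 1) / ε))
    have l3 : ∫ q, ε * ((fun q => η (k + 1) q ^ 2 * E q) - (fun q => η k q ^ 2 * E q)) q =
        ε * ((∫ q, η (k + 1) q ^ 2 * E q) - ∫ q, η k q ^ 2 * E q) := by
      rw [integral_const_mul]; congr 1; exact integral_sub I1 I0
    rw [l3, integral_const_mul] at l2
    rw [l1] at hi
    have hi2 := hi.trans_eq l2
    have h5 : (2 * C ^ 2 / 4 ^ (k + 1) / ε) * (∫ q, η (k + 2) q ^ 2 * (pdx u q ^ 2 + pdy u q ^ 2))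
        ≤ 8 * C ^ 2 * B / ε := by
      refine (mul_le_mul_of_nonneg_left (hen (k + 2)) (by positivity)).trans_eq ?_
      have : (4 : ℝ) ^ (k + 2) = 4 * 4 ^ (k + 1) := by ring
      rw [this]
      field_simp
      ring
    linarith

/-- First integral: for an increasing solution with limit `1`, the energy is `-F 1`. -/
lemma dg_first {F h : ℝ → ℝ} (hF : ContDiff ℝ 1 F) (hh : ContDiff ℝ 2 h)
    (hODE : ∀ t, deriv (deriv h) t = deriv F (h t)) (hpos : ∀ t, 0 < deriv h t)
    (hbd : ∀ t, h t ≤ 1) (hlim : Tendsto h atTop (𝓝 1)) (t : ℝ) :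
    deriv h t ^ 2 = 2 * (F (h t) - F 1) := by
  have d1 : Differentiable ℝ h := hh.differentiable two_ne_zero
  have d2 : Differentiable ℝ (deriv h) := by
    have : ContDiff ℝ 1 (deriv h) := ((contDiff_succ_iff_deriv (n := 1)).1 (by rw [one_add_one_eq_two]; exact hh)).2.2
    exact this.differentiable one_ne_zero
  have hd : ∀ t, HasDerivAt (fun t => deriv h t ^ 2 - 2 * F (h t)) 0 t := by
    intro t
    have a1 : HasDerivAt (fun t => F (h t)) (deriv F (h t) * deriv h t) t :=
      HasDerivAt.comp (h₂ := F) t (hF.differentiable one_ne_zero (h t)).hasDerivAt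
        (d1 t).hasDerivAt
    have a2 := ((d2 t).hasDerivAt.pow 2).sub (a1.const_mul 2)
    refine a2.congr_deriv ?_
    rw [hODE]; push_cast; ring
  have hconst : ∀ s, deriv h s ^ 2 - 2 * F (h s) = deriv h t ^ 2 - 2 * F (h t) := fun s =>
    is_const_of_deriv_eq_zero (fun x => (hd x).differentiableAt) (fun x => (hd x).deriv) s t
  set c := deriv h t ^ 2 - 2 * F (h t) with hc
  have hl : Tendsto (fun s => deriv h s ^ 2) atTop (𝓝 (c + 2 * F 1)) := by
    have : Tendsto (fun s => c + 2 * F (h s)) atTop (𝓝 (c + 2 * F 1)) :=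
      (((hF.continuous.tendsto 1).comp hlim).const_mul 2).const_add c
    refine this.congr fun s => ?_
    have := hconst s
    linarith
  have hge : 0 ≤ c + 2 * F 1 := ge_of_tendsto' hl fun s => sq_nonneg _
  have hle : c + 2 * F 1 ≤ 0 := by
    by_contra hcon
    push Not at hcon
    set L := c + 2 * F 1
    have hr : Tendsto (fun s => deriv h s) atTop (𝓝 (Real.sqrt L)) := by
      have := (Real.continuous_sqrt.tendsto L).comp hl
      refine this.congr fun s => ?_
      exact Real.sqrt_sq (hpos s).le
    have hsq : 0 < Real.sqrt L := Real.sqrt_pos.2 hcon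
    set δ := Real.sqrt L / 2
    have hδ : 0 < δ := by positivity
    obtain ⟨Y, hY⟩ := eventually_atTop.1 (hr.eventually (lt_mem_nhds (half_lt_self hsq)))
    have hmv : ∀ s, Y ≤ s → δ * (s - Y) ≤ h s - h Y := by
      intro s hs
      refine Convex.mul_sub_le_image_sub_of_le_deriv (convex_Ici Y) d1.continuous.continuousOn
        d1.differentiableOn (C := δ) ?_ Y (Set.self_mem_Ici) s hs hs
      intro x hx
      rw [interior_Ici] at hx
      exact (hY x (le_of_lt hx)).le
    have h3 := hmv (Y + (2 + |h Y|) / δ) (by have : 0 ≤ (2 + |h Y|) / δ := by positivity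
                                             linarith)
    have h4 : δ * (Y + (2 + |h Y|) / δ - Y) = 2 + |h Y| := by field_simp; ring
    rw [h4] at h3
    have := hbd (Y + (2 + |h Y|) / δ)
    have := neg_abs_le (h Y)
    linarith
  have : c + 2 * F 1 = 0 := le_antisymm hle hge
  linarith

lemma dg_unique {F h H : ℝ → ℝ} (hF : ContDiff ℝ 2 F) (hh : ContDiff ℝ 2 h) (hH : ContDiff ℝ 2 H)
    (o1 : ∀ t, deriv (deriv h) t = deriv F (h t)) (o2 : ∀ t, deriv (deriv H) t = deriv F (H t))
    (b1 : ∀ t, |h t| ≤ 1) (b2 : ∀ t, |H t| ≤ 1)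
    (e0 : h 0 = H 0) (e1 : deriv h 0 = deriv H 0) : h = H := by
  have hF' : ContDiff ℝ 1 (deriv F) :=
    ((contDiff_succ_iff_deriv (n := 1)).1 (by rw [one_add_one_eq_two]; exact hF)).2.2
  have dd : ∀ {g : ℝ → ℝ}, ContDiff ℝ 2 g → Differentiable ℝ (deriv g) := by
    intro g hg
    have : ContDiff ℝ 1 (deriv g) := ((contDiff_succ_iff_deriv (n := 1)).1 (by rw [one_add_one_eq_two]; exact hg)).2.2
    exact this.differentiable one_ne_zero
  obtain ⟨K, hK⟩ := hF'.contDiffOn.exists_lipschitzOnWith (s := Set.Icc (-1 : ℝ) 1) one_ne_zero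
    (convex_Icc _ _) isCompact_Icc
  have hv : LipschitzOnWith (max 1 (K * 1)) (fun z : ℝ × ℝ => (z.2, deriv F z.1))
      (Set.Icc (-1 : ℝ) 1 ×ˢ Set.univ) := by
    refine LipschitzOnWith.prodMk ?_ ?_
    · exact LipschitzWith.prod_snd.lipschitzOnWith
    · exact hK.comp LipschitzWith.prod_fst.lipschitzOnWith (fun z hz => hz.1)
  have sol : ∀ {g : ℝ → ℝ}, ContDiff ℝ 2 g → (∀ t, deriv (deriv g) t = deriv F (g t)) →
      (∀ t, |g t| ≤ 1) → ∀ t, HasDerivAt (fun t => (g t, deriv g t))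
        ((fun (_ : ℝ) (z : ℝ × ℝ) => (z.2, deriv F z.1)) t (g t, deriv g t)) t ∧
        (g t, deriv g t) ∈ (fun _ : ℝ => Set.Icc (-1 : ℝ) 1 ×ˢ (Set.univ : Set ℝ)) t := by
    intro g hg og bg t
    refine ⟨?_, abs_le.1 (bg t), Set.mem_univ _⟩
    have a1 := (hg.differentiable two_ne_zero t).hasDerivAt
    have a2 := (dd hg t).hasDerivAt
    rw [og] at a2
    exact a1.prodMk a2
  have := ODE_solution_unique_univ (t₀ := 0) (fun t => hv) (sol hh o1 b1) (sol hH o2 b2)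
    (by simp [e0, e1])
  funext t
  exact congrArg Prod.fst (congrFun this t)

/-- De Giorgi in the plane with symmetry: a bounded solution of
`Δu = F'(u)` which is monotone in `y`, even in `x`, normalized by `u(0,0) = 0` and
tending to `±1` as `y → ±∞`, is one-dimensional: `u(x,y) = H(y)`; in particular
`∂ₓu ≡ 0`. -/
theorem de_giorgi_symmetry
    (F : ℝ → ℝ) (hF : ContDiff ℝ (⊤ : ℕ∞) F)
    (u : ℝ × ℝ → ℝ) (hu : ContDiff ℝ 2 u)
    (hubdd : ∀ p : ℝ × ℝ, |u p| ≤ 1)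
    (hsol : ∀ p : ℝ × ℝ, lap u p = deriv F (u p))
    (hmono : ∀ p : ℝ × ℝ, 0 < pdy u p)
    (heven : ∀ x y : ℝ, u (x, y) = u (-x, y))
    (hnorm : u (0, 0) = 0)
    (hlim1 : ∀ x : ℝ, Tendsto (fun y => u (x, y)) atTop (nhds 1))
    (hlim2 : ∀ x : ℝ, Tendsto (fun y => u (x, y)) atBot (nhds (-1)))
    (H : ℝ → ℝ) (hH : ContDiff ℝ 2 H)
    (hODE : ∀ t : ℝ, deriv (deriv H) t = deriv F (H t))
    (hH0 : H 0 = 0)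
    (hHtop : Tendsto H atTop (nhds 1)) (hHbot : Tendsto H atBot (nhds (-1)))
    (hH' : ∀ t : ℝ, 0 < deriv H t) :
    (∀ x y : ℝ, u (x, y) = H y) ∧ (∀ p : ℝ × ℝ, pdx u p = 0) := by
  have hu1 := hu.of_le one_le_two
  have hF2 : ContDiff ℝ 2 F := contDiff_infty.1 hF 2
  have hF1 : ContDiff ℝ 1 F := hF.of_le (by exact_mod_cast le_top)
  have dσ : ContDiff ℝ 1 (fun q => pdx u q / pdy u q) :=
    (dg_cdX hu).div (dg_cdY hu) (fun q => (hmono q).ne')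
  have hx0 : ∀ y, pdx u (0, y) = 0 := by
    intro y
    have h1 := dg_hasX hu1 (0, y)
    have h2 : HasDerivAt (fun t => u (t, y)) (-pdx u (0, y)) 0 := by
      have h3 : HasDerivAt (fun t => u (t, y)) (pdx u (0, y)) (-0) := by simpa using h1
      have h4 := HasDerivAt.comp (h₂ := fun t => u (t, y)) (0 : ℝ) h3 (hasDerivAt_neg (0 : ℝ))
      have h5 := h4.congr_of_eventuallyEq (f₁ := fun t => u (t, y))
        (Filter.Eventually.of_forall fun t => heven t y)
      simpa using h5
    have := h1.unique h2
    linarith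
  have hpx : ∀ p, pdx u p = 0 := by
    rintro ⟨x, y⟩
    have hc := is_const_of_deriv_eq_zero (f := fun t => pdx u (t, y) / pdy u (t, y))
      (fun t => (dg_hasX dσ (t, y)).differentiableAt)
      (fun t => dg_flat hF hu hubdd hsol hmono (t, y)) x 0
    simp only [hx0, zero_div] at hc
    exact (div_eq_zero_iff.1 hc).resolve_right (hmono (x, y)).ne'
  refine ⟨?_, hpx⟩
  have hconst : ∀ x y, u (x, y) = u (0, y) := fun x y =>
    is_const_of_deriv_eq_zero (f := fun t => u (t, y))
      (fun t => (dg_hasX hu1 (t, y)).differentiableAt) (fun t => hpx (t, y)) x 0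
  have hh : ContDiff ℝ 2 (fun y => u (0, y)) := hu.comp (contDiff_const.prodMk contDiff_id)
  have hd : deriv (fun y => u (0, y)) = fun y => pdy u (0, y) := rfl
  have ho : ∀ t, deriv (deriv (fun y => u (0, y))) t = deriv F (u (0, t)) := by
    intro t
    have e := hsol (0, t)
    have : pdx u = fun _ => 0 := funext hpx
    have e2 : pdx (pdx u) (0, t) = 0 := by rw [this]; simp [pdx]
    unfold lap at e
    rw [e2, zero_add] at e
    exact e
  have hHm : Monotone H := (strictMono_of_deriv_pos hH').monotone
  have bH : ∀ t, |H t| ≤ 1 := fun t =>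
    abs_le.2 ⟨hHm.le_of_tendsto hHbot t, hHm.ge_of_tendsto hHtop t⟩
  have f1 := dg_first hF1 hh ho (fun t => hmono (0, t)) (fun t => (abs_le.1 (hubdd _)).2)
    (hlim1 0) 0
  have f2 := dg_first hF1 hH hODE hH' (fun t => (abs_le.1 (bH t)).2) hHtop 0
  have e1 : deriv (fun y => u (0, y)) 0 = deriv H 0 := by
    have a1 : 0 ≤ deriv (fun y => u (0, y)) 0 := (hmono (0, 0)).le
    refine (pow_left_inj₀ a1 (hH' 0).le two_ne_zero).1 ?_
    rw [f1, f2, hnorm, hH0]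
  have := dg_unique hF2 hh hH ho hODE (fun t => hubdd _) bH (by rw [hnorm, hH0]) e1
  intro x y
  rw [hconst]
  exact congrFun this y
end
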